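/- arXiv:1706.03494 — 9 statements merged into one kernel-verified Lean document; each statement's English description precedes it below -/
import Mathlib

section
/- There exist a real number λ₀ > 0 and a function φ₀ : S̄ → ℝ such that φ₀(x) > 0 for all x ∈ S, φ₀(x) = 0 for all x ∈ ∂S, ∑_{x∈S} φ₀(x)² = 1, and −Δ_ω φ₀(x) = λ₀ φ₀(x) for all x ∈ S. -/
open Finset

/-- The negative of the weighted graph Laplacian. -/
noncomputable def negLaplacian {V : Type*} [Fintype V] (ω : V → V → ℝ) (u : V → ℝ) (x : V) : ℝ :=
  ∑ y, (u x - u y) * ω x y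

/-- The Dirichlet energy of a function on a weighted graph. -/
noncomputable def dirichletEnergy {V : Type*} [Fintype V] (ω : V → V → ℝ) (u : V → ℝ) : ℝ :=
  ∑ x, u x * negLaplacian ω u x

section DirichletEnergy

variable {V : Type*} [Fintype V] {ω : V → V → ℝ}

theorem negLaplacian_add_smul (u v : V → ℝ) (t : ℝ) (x : V) :
    negLaplacian ω (u + t • v) x = negLaplacian ω u x + t * negLaplacian ω v x := by
  simp only [negLaplacian, mul_sum, ← sum_add_distrib]
  refine sum_congr rfl fun y _ => ?_
  simp only [Pi.add_apply, Pi.smul_apply, smul_eq_mul]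
  ring

theorem sum_mul_negLaplacian_comm (hsymm : ∀ x y, ω x y = ω y x) (u v : V → ℝ) :
    ∑ x, u x * negLaplacian ω v x = ∑ x, v x * negLaplacian ω u x := by
  have key : ∑ x, ∑ y, u x * v y * ω x y = ∑ x, ∑ y, v x * u y * ω x y := by
    rw [sum_comm]
    refine sum_congr rfl fun x _ => sum_congr rfl fun y _ => ?_
    rw [hsymm y x]
    ring
  have expand : ∀ f g : V → ℝ, ∑ x, f x * negLaplacian ω g x =
      ∑ x, ∑ y, f x * g x * ω x y - ∑ x, ∑ y, f x * g y * ω x y := by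
    intro f g
    simp only [negLaplacian, mul_sum, ← sum_sub_distrib]
    exact sum_congr rfl fun x _ => sum_congr rfl fun y _ => by ring
  rw [expand, expand, key]
  simp only [mul_comm (u _) (v _)]

theorem sum_negLaplacian (hsymm : ∀ x y, ω x y = ω y x) (u : V → ℝ) :
    ∑ x, negLaplacian ω u x = 0 := by
  simpa [negLaplacian] using sum_mul_negLaplacian_comm hsymm 1 u

theorem dirichletEnergy_add_smul (hsymm : ∀ x y, ω x y = ω y x) (u v : V → ℝ) (t : ℝ) :
    dirichletEnergy ω (u + t • v) = dirichletEnergy ω u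
      + 2 * t * ∑ x, v x * negLaplacian ω u x + t ^ 2 * dirichletEnergy ω v := by
  have h : dirichletEnergy ω (u + t • v) = dirichletEnergy ω u
      + t * ∑ x, u x * negLaplacian ω v x
      + t * ∑ x, v x * negLaplacian ω u x + t ^ 2 * dirichletEnergy ω v := by
    simp only [dirichletEnergy, negLaplacian_add_smul, mul_sum, ← sum_add_distrib]
    refine sum_congr rfl fun x _ => ?_
    simp only [Pi.add_apply, Pi.smul_apply, smul_eq_mul]
    ring
  rw [h, sum_mul_negLaplacian_comm hsymm u v]
  ring

theorem dirichletEnergy_smul (u : V → ℝ) (t : ℝ) :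
    dirichletEnergy ω (t • u) = t ^ 2 * dirichletEnergy ω u := by
  simp only [dirichletEnergy, negLaplacian, mul_sum]
  refine sum_congr rfl fun x _ => sum_congr rfl fun y _ => ?_
  simp only [Pi.smul_apply, smul_eq_mul]
  ring

theorem dirichletEnergy_abs_le (hnonneg : ∀ x y, 0 ≤ ω x y) (u : V → ℝ) :
    dirichletEnergy ω (fun x => |u x|) ≤ dirichletEnergy ω u := by
  simp only [dirichletEnergy, negLaplacian, mul_sum, ← mul_assoc]
  refine sum_le_sum fun x _ => sum_le_sum fun y _ => ?_
  refine mul_le_mul_of_nonneg_right ?_ (hnonneg x y)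
  have h : u x * u y ≤ |u x| * |u y| := by
    rw [← abs_mul]
    exact le_abs_self _
  nlinarith [abs_mul_abs_self (u x)]

theorem continuous_dirichletEnergy : Continuous (dirichletEnergy (V := V) ω) := by
  unfold dirichletEnergy negLaplacian
  fun_prop

theorem negLaplacian_eq_of_eq_zero {u : V → ℝ} {x : V} (hx : u x = 0) :
    negLaplacian ω u x = -∑ y, u y * ω x y := by
  simp [negLaplacian, hx]

/-- The Rayleigh quotient attains its minimum at a nonnegative normalized function. -/
theorem exists_nonneg_minimizer [DecidableEq V] {S : Finset V} (hS : S.Nonempty)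
    (hnonneg : ∀ x y, 0 ≤ ω x y) :
    ∃ u : V → ℝ, (∀ x, 0 ≤ u x) ∧ (∀ x ∉ S, u x = 0) ∧ ∑ x, u x ^ 2 = 1 ∧
      ∀ v : V → ℝ, (∀ x ∉ S, v x = 0) →
        dirichletEnergy ω u * ∑ x, v x ^ 2 ≤ dirichletEnergy ω v := by
  set K : Set (V → ℝ) := {u | (∀ x ∉ S, u x = 0) ∧ ∑ x, u x ^ 2 = 1} with hK
  have hcompact : IsCompact K := by
    refine (isCompact_univ_pi (s := fun _ : V => Set.Icc (-1 : ℝ) 1)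
      fun _ => isCompact_Icc).of_isClosed_subset ?_ ?_
    · refine IsClosed.inter (s₁ := {u : V → ℝ | ∀ x ∉ S, u x = 0}) ?_
        (isClosed_eq (by fun_prop) continuous_const)
      simp only [Set.ofPred_forall]
      exact isClosed_iInter fun x => isClosed_iInter fun _ =>
        isClosed_eq (continuous_apply x) continuous_const
    · rintro u ⟨-, hu⟩ x -
      have h : u x ^ 2 ≤ ∑ y, u y ^ 2 :=
        single_le_sum (f := fun y => u y ^ 2) (fun y _ => sq_nonneg _) (mem_univ x)
      rw [hu] at h
      exact ⟨by nlinarith, by nlinarith⟩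
  have hne : K.Nonempty := by
    obtain ⟨a, ha⟩ := hS
    refine ⟨Pi.single a 1, fun x hx => ?_, ?_⟩
    · exact Pi.single_eq_of_ne (fun h : x = a => hx (h ▸ ha)) _
    · simp [Pi.single_apply]
  obtain ⟨u, ⟨hu0, hu1⟩, hmin⟩ := hcompact.exists_isMinOn hne
    (continuous_dirichletEnergy (ω := ω)).continuousOn
  refine ⟨fun x => |u x|, fun x => abs_nonneg _, fun x hx => by simp [hu0 x hx],
    by simpa using hu1, fun v hv => ?_⟩
  have hQ : 0 ≤ ∑ x, v x ^ 2 := sum_nonneg fun x _ => sq_nonneg _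
  refine (mul_le_mul_of_nonneg_right (dirichletEnergy_abs_le hnonneg u) hQ).trans ?_
  rcases hQ.eq_or_lt with h0 | hpos
  · have hv0 : ∀ x, v x = 0 := fun x => by
      simpa using (sum_eq_zero_iff_of_nonneg fun y _ => sq_nonneg (v y)).1 h0.symm x (mem_univ x)
    simp [dirichletEnergy, hv0]
  · set q := ∑ x, v x ^ 2 with hq
    have hsq : (√q)⁻¹ ^ 2 = q⁻¹ := by rw [inv_pow, Real.sq_sqrt hQ]
    have hmem : (√q)⁻¹ • v ∈ K := by
      refine ⟨fun x hx => by simp [hv x hx], ?_⟩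
      simp only [Pi.smul_apply, smul_eq_mul, mul_pow, ← mul_sum, hsq, ← hq]
      exact inv_mul_cancel₀ hpos.ne'
    have h : dirichletEnergy ω u ≤ dirichletEnergy ω ((√q)⁻¹ • v) := hmin hmem
    rw [dirichletEnergy_smul, hsq, inv_mul_eq_div] at h
    exact (le_div_iff₀ hpos).1 h

/-- Euler–Lagrange equation for a normalized minimizer of the Rayleigh quotient. -/
theorem negLaplacian_eq_of_minimizer [DecidableEq V] {S : Finset V}
    (hsymm : ∀ x y, ω x y = ω y x) {u : V → ℝ} (hu0 : ∀ x ∉ S, u x = 0)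
    (hu1 : ∑ x, u x ^ 2 = 1)
    (hmin : ∀ v : V → ℝ, (∀ x ∉ S, v x = 0) →
      dirichletEnergy ω u * ∑ x, v x ^ 2 ≤ dirichletEnergy ω v) {x : V} (hx : x ∈ S) :
    negLaplacian ω u x = dirichletEnergy ω u * u x := by
  set e : V → ℝ := Pi.single x 1 with he
  have hsum : ∀ f : V → ℝ, ∑ y, e y * f y = f x := fun f => by simp [he, Pi.single_apply]
  have hquad : ∀ t : ℝ, 0 ≤ (dirichletEnergy ω e - dirichletEnergy ω u) * (t * t)
      + 2 * (negLaplacian ω u x - dirichletEnergy ω u * u x) * t + 0 := by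
    intro t
    have h := hmin (u + t • e) fun y hy => by
      have hyx : y ≠ x := fun h => hy (h ▸ hx)
      simp [he, hu0 y hy, hyx]
    have hnorm : ∑ y, (u + t • e) y ^ 2 = 1 + 2 * t * u x + t ^ 2 := by
      have h1 : ∑ y, (u + t • e) y ^ 2
          = ∑ y, u y ^ 2 + 2 * t * ∑ y, e y * u y + t ^ 2 * ∑ y, e y * e y := by
        simp only [mul_sum, ← sum_add_distrib]
        refine sum_congr rfl fun y _ => ?_
        simp only [Pi.add_apply, Pi.smul_apply, smul_eq_mul]
        ring
      rw [h1, hsum, hsum, hu1]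
      simp [he]
    rw [dirichletEnergy_add_smul hsymm, hsum, hnorm] at h
    linarith
  have hdisc := discrim_le_zero hquad
  rw [discrim] at hdisc
  have hzero : negLaplacian ω u x - dirichletEnergy ω u * u x = 0 := by
    rw [← sq_eq_zero_iff]
    exact le_antisymm (by linarith) (sq_nonneg _)
  linarith

/-- Strong minimum principle: a nonnegative eigenfunction vanishing at one interior vertex
vanishes at every vertex connected to it. -/
theorem eq_zero_of_reflTransGen {S : Finset V} (hnonneg : ∀ x y, 0 ≤ ω x y) {u : V → ℝ}
    {lam : ℝ} (hu : ∀ x, 0 ≤ u x) (heig : ∀ x ∈ S, negLaplacian ω u x = lam * u x) {x y : V}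
    (hxy : Relation.ReflTransGen (fun a b => a ∈ S ∧ b ∈ S ∧ 0 < ω a b) x y) (hx : u x = 0) :
    u y = 0 := by
  induction hxy with
  | refl => exact hx
  | @tail b c _ hbc ih =>
    obtain ⟨hb, -, hω⟩ := hbc
    have h := heig b hb
    rw [negLaplacian_eq_of_eq_zero ih, ih, mul_zero, neg_eq_zero,
      sum_eq_zero_iff_of_nonneg fun z _ => mul_nonneg (hu z) (hnonneg b z)] at h
    exact (mul_eq_zero.1 (h c (mem_univ c))).resolve_right hω.ne'

end DirichletEnergy

/-- **Existence of the first Dirichlet eigenpair (Lemma 2.2, existence part).**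
A network: a finite vertex set `V = S̄`, an interior `S` (nonempty) whose
complement `∂S = Sᶜ` (nonempty) is the boundary, and a symmetric nonnegative
weight `ω` vanishing on the diagonal; `x ∼ y` iff `0 < ω x y`.  The graph
induced on `S` is connected and every boundary vertex is adjacent to some
interior vertex.  Then there exist `λ₀ > 0` and `φ₀ : S̄ → ℝ` with `φ₀ > 0`
on `S`, `φ₀ = 0` on `∂S`, `∑_{x ∈ S} φ₀(x)² = 1`, and
`-Δ_ω φ₀ x = λ₀ φ₀ x` for all `x ∈ S`. -/
theorem exists_first_dirichlet_eigenpair {V : Type*} [Fintype V] [DecidableEq V]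
    (S : Finset V) (hS : S.Nonempty) (hSc : Sᶜ.Nonempty)
    (ω : V → V → ℝ)
    (hsymm : ∀ x y, ω x y = ω y x)
    (hnonneg : ∀ x y, 0 ≤ ω x y)
    (hdiag : ∀ x, ω x x = 0)
    (hconn : ∀ x ∈ S, ∀ y ∈ S,
      Relation.ReflTransGen (fun a b => a ∈ S ∧ b ∈ S ∧ 0 < ω a b) x y)
    (hbadj : ∀ z ∉ S, ∃ y ∈ S, 0 < ω z y) :
    ∃ (lam : ℝ) (φ : V → ℝ), 0 < lam ∧
      (∀ x ∈ S, 0 < φ x) ∧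
      (∀ x ∉ S, φ x = 0) ∧
      (∑ x ∈ S, (φ x) ^ 2 = 1) ∧
      (∀ x ∈ S, -(∑ y, (φ y - φ x) * ω x y) = lam * φ x) := by
  obtain ⟨u, hu, hu0, hu1, hmin⟩ := exists_nonneg_minimizer (ω := ω) hS hnonneg
  have heig : ∀ x ∈ S, negLaplacian ω u x = dirichletEnergy ω u * u x := fun x hx =>
    negLaplacian_eq_of_minimizer hsymm hu0 hu1 hmin hx
  have hpos : ∀ x ∈ S, 0 < u x := by
    intro x hx
    refine (hu x).lt_of_ne' fun hx0 => ?_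
    have hzero : ∀ y, u y = 0 := fun y => by
      by_cases hy : y ∈ S
      · exact eq_zero_of_reflTransGen hnonneg hu heig (hconn x hx y hy) hx0
      · exact hu0 y hy
    simp [hzero] at hu1
  have hneg : ∑ x ∈ Sᶜ, negLaplacian ω u x < 0 := by
    refine sum_neg (fun z hz => ?_) hSc
    have hzS : z ∉ S := mem_compl.1 hz
    obtain ⟨y, hy, hω⟩ := hbadj z hzS
    rw [negLaplacian_eq_of_eq_zero (hu0 z hzS), neg_lt_zero]
    exact sum_pos' (fun w _ => mul_nonneg (hu w) (hnonneg z w))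
      ⟨y, mem_univ y, mul_pos (hpos y hy) hω⟩
  have hlam : 0 < dirichletEnergy ω u := by
    have hsplit := sum_add_sum_compl S (negLaplacian ω u)
    rw [sum_negLaplacian hsymm, sum_congr rfl heig, ← mul_sum] at hsplit
    exact pos_of_mul_pos_left (by linarith) (sum_nonneg fun x _ => hu x)
  refine ⟨dirichletEnergy ω u, u, hlam, hpos, hu0, ?_, fun x hx => ?_⟩
  · rw [← hu1]
    exact sum_subset (subset_univ S) fun x _ hx => by simp [hu0 x hx]
  · rw [← heig x hx, negLaplacian, ← sum_neg_distrib]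
    exact sum_congr rfl fun y _ => by ring
end

section
/- (Comparison principle) Let T ∈ (0,∞] and let f : ℝ → ℝ be locally Lipschitz continuous. Suppose u, v : S̄ × [0,T) → ℝ are such that for each x ∈ S̄ the maps t ↦ u(x,t) and t ↦ v(x,t) are continuous on [0,T) and differentiable on (0,T), and they satisfy: u_t(x,t) − Δ_ω u(x,t) − f(u(x,t)) ≥ v_t(x,t) − Δ_ω v(x,t) − f(v(x,t)) for all (x,t) ∈ S × (0,T); u(x,t) ≥ v(x,t) for all (x,t) ∈ ∂S × [0,T); and u(x,0) ≥ v(x,0) for all x ∈ S̄. Then u(x,t) ≥ v(x,t) for all (x,t) ∈ S̄ × [0,T). -/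
open Finset

/-- If `g` attains its minimum over `[a, t]` at the right endpoint, its derivative there is
nonpositive. -/
theorem HasDerivAt.nonpos_of_forall_Icc_le {g : ℝ → ℝ} {g' a t : ℝ} (hg : HasDerivAt g g' t)
    (hat : a < t) (hmin : ∀ s ∈ Set.Icc a t, g t ≤ g s) : g' ≤ 0 := by
  refine le_of_tendsto (hasDerivAt_iff_tendsto_slope_left_right.1 hg).1 ?_
  filter_upwards [Ioo_mem_nhdsLT hat] with s hs
  rw [slope_def_field]
  exact div_nonpos_of_nonneg_of_nonpos (sub_nonneg.2 (hmin s ⟨hs.1.le, hs.2.le⟩))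
    (sub_nonpos.2 hs.2.le)

/-- A finite family of continuous functions on a compact set has a common minimum. -/
theorem IsCompact.exists_forall_le_of_finite {V X : Type*} [Finite V] [Nonempty V]
    [TopologicalSpace X] {s : Set X} (hs : IsCompact s) (hne : s.Nonempty) {z : V → X → ℝ}
    (hz : ∀ x, ContinuousOn (z x) s) :
    ∃ x₀, ∃ t₀ ∈ s, ∀ x, ∀ t ∈ s, z x₀ t₀ ≤ z x t := by
  choose τ hτ hmin using fun x => hs.exists_isMinOn hne (hz x)
  obtain ⟨x₀, hx₀⟩ := Finite.exists_min fun x => z x (τ x)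
  exact ⟨x₀, τ x₀, hτ x₀, fun x t ht => (hx₀ x).trans (hmin x ht)⟩

/-- A locally Lipschitz function is uniformly Lipschitz along the values of finitely many
continuous functions on a compact set. -/
theorem LocallyLipschitz.exists_abs_sub_le_of_compact {V X : Type*} [Finite V]
    [TopologicalSpace X] {s : Set X} (hs : IsCompact s) {f : ℝ → ℝ} (hf : LocallyLipschitz f)
    {u v : V → X → ℝ} (hu : ∀ x, ContinuousOn (u x) s) (hv : ∀ x, ContinuousOn (v x) s) :
    ∃ L : ℝ, ∀ x, ∀ t ∈ s, |f (u x t) - f (v x t)| ≤ L * |u x t - v x t| := by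
  have hK : IsCompact (⋃ x, (u x '' s ∪ v x '' s)) :=
    isCompact_iUnion fun x => (hs.image_of_continuousOn (hu x)).union
      (hs.image_of_continuousOn (hv x))
  obtain ⟨L, hL⟩ := hf.locallyLipschitzOn.exists_lipschitzOnWith_of_compact hK
  refine ⟨L, fun x t ht => ?_⟩
  simpa only [Real.dist_eq] using hL.dist_le_mul
    (u x t) (Set.mem_iUnion.2 ⟨x, Or.inl ⟨t, ht, rfl⟩⟩)
    (v x t) (Set.mem_iUnion.2 ⟨x, Or.inr ⟨t, ht, rfl⟩⟩)

/-- **Comparison principle (Theorem 2.4).**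
Network: finite `V = S̄`, nonempty interior `S`, nonempty boundary `Sᶜ`,
symmetric nonnegative weight `ω` vanishing on the diagonal;
`Δ_ω w (x,t) = ∑ y, (w y t - w x t) * ω x y`.  Let `T ∈ (0,∞]` (as an
extended real), `f` locally Lipschitz, and let `u, v` be continuous in time on
`[0,T)` and differentiable on `(0,T)` at each vertex (with time derivatives
`ut, vt`).  If
`ut - Δ_ω u - f(u) ≥ vt - Δ_ω v - f(v)` on `S × (0,T)`,
`u ≥ v` on `∂S × [0,T)`, and `u(·,0) ≥ v(·,0)` on `S̄`,
then `u ≥ v` on `S̄ × [0,T)`. -/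
theorem comparison_principle {V : Type*} [Fintype V] [DecidableEq V]
    (S : Finset V) (hS : S.Nonempty) (hSc : Sᶜ.Nonempty)
    (ω : V → V → ℝ)
    (hsymm : ∀ x y, ω x y = ω y x)
    (hnonneg : ∀ x y, 0 ≤ ω x y)
    (hdiag : ∀ x, ω x x = 0)
    (T : EReal) (hT : 0 < T)
    (f : ℝ → ℝ) (hf : LocallyLipschitz f)
    (u v ut vt : V → ℝ → ℝ)
    (hucont : ∀ x, ContinuousOn (u x) {t : ℝ | 0 ≤ t ∧ (t : EReal) < T})
    (hvcont : ∀ x, ContinuousOn (v x) {t : ℝ | 0 ≤ t ∧ (t : EReal) < T})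
    (huder : ∀ x, ∀ t : ℝ, 0 < t → (t : EReal) < T → HasDerivAt (u x) (ut x t) t)
    (hvder : ∀ x, ∀ t : ℝ, 0 < t → (t : EReal) < T → HasDerivAt (v x) (vt x t) t)
    (hineq : ∀ x ∈ S, ∀ t : ℝ, 0 < t → (t : EReal) < T →
      vt x t - (∑ y, (v y t - v x t) * ω x y) - f (v x t) ≤
        ut x t - (∑ y, (u y t - u x t) * ω x y) - f (u x t))
    (hbdry : ∀ x ∉ S, ∀ t : ℝ, 0 ≤ t → (t : EReal) < T → v x t ≤ u x t)
    (hinit : ∀ x, v x 0 ≤ u x 0) :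
    ∀ x, ∀ t : ℝ, 0 ≤ t → (t : EReal) < T → v x t ≤ u x t := by
  intro x₀ t₀ ht₀ ht₀T
  have hlt : ∀ t ∈ Set.Icc 0 t₀, (t : EReal) < T := fun t ht =>
    (EReal.coe_le_coe_iff.2 ht.2).trans_lt ht₀T
  have hsub : Set.Icc 0 t₀ ⊆ {t : ℝ | 0 ≤ t ∧ (t : EReal) < T} := fun t ht => ⟨ht.1, hlt t ht⟩
  have hu x := (hucont x).mono hsub
  have hv x := (hvcont x).mono hsub
  obtain ⟨L, hL⟩ := hf.exists_abs_sub_le_of_compact isCompact_Icc hu hv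
  have : Nonempty V := ⟨x₀⟩
  obtain ⟨x, t, ht, hmin⟩ := isCompact_Icc.exists_forall_le_of_finite (Set.nonempty_Icc.2 ht₀)
    (z := fun x t => Real.exp (-(L + 1) * t) * (u x t - v x t))
    (fun x => (by fun_prop : Continuous fun t : ℝ => Real.exp (-(L + 1) * t)).continuousOn.mul
      ((hu x).sub (hv x)))
  by_contra! hneg
  have hz : Real.exp (-(L + 1) * t) * (u x t - v x t) < 0 :=
    (hmin x₀ t₀ ⟨ht₀, le_rfl⟩).trans_lt
      (mul_neg_of_pos_of_neg (Real.exp_pos _) (sub_neg.2 hneg))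
  have hw : u x t - v x t < 0 := (pos_iff_neg_of_mul_neg hz).1 (Real.exp_pos _)
  have hxS : x ∈ S := by
    by_contra hx
    linarith [hbdry x hx t ht.1 (hlt t ht)]
  have htpos : 0 < t := by
    refine ht.1.lt_of_ne ?_
    rintro rfl
    linarith [hinit x]
  have hlap : ∑ y, (v y t - v x t) * ω x y ≤ ∑ y, (u y t - u x t) * ω x y := by
    refine Finset.sum_le_sum fun y _ => mul_le_mul_of_nonneg_right ?_ (hnonneg x y)
    linarith [le_of_mul_le_mul_left (hmin y t ht) (Real.exp_pos _)]
  have hexp : HasDerivAt (fun t : ℝ => Real.exp (-(L + 1) * t))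
      (Real.exp (-(L + 1) * t) * -(L + 1)) t := by
    simpa using ((hasDerivAt_id t).const_mul (-(L + 1))).exp
  have hder := (hexp.mul ((huder x t htpos (hlt t ht)).sub (hvder x t htpos (hlt t ht)))
    ).nonpos_of_forall_Icc_le htpos fun s hs => hmin x s ⟨hs.1, hs.2.trans ht.2⟩
  have hdw : (ut x t - vt x t) - (L + 1) * (u x t - v x t) ≤ 0 := by
    refine nonpos_of_mul_nonpos_right (a := Real.exp (-(L + 1) * t)) ?_ (Real.exp_pos _)
    simp only [Pi.sub_apply] at hder
    linarith
  have hLx := (abs_le.1 (hL x t ht)).1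
  rw [abs_of_neg hw] at hLx
  linarith [hineq x hxS t htpos (hlt t ht)]
end

section
/- (Concavity method, main theorem) Let f : ℝ → ℝ be locally Lipschitz continuous with f(0) = 0 and f(u) > 0 for all u > 0, and suppose f satisfies condition (C): there exist α, β, γ > 0 with β ≤ (α−2)λ₀/2 such that α F(u) ≤ u f(u) + β u² + γ for all u > 0. Let u₀ : S̄ → ℝ satisfy u₀ = 0 on ∂S, u₀ ≥ 0 on S̄, u₀(x*) > 0 for some x* ∈ S, and J(u₀) = −(1/4) ∑_{x,y∈S̄} [u₀(x) − u₀(y)]² ω(x,y) + ∑_{x∈S̄} [F(u₀(x)) − γ] > 0. Then there is no solution of the discrete semilinear heat equation with initial data u₀ defined on all of [0,∞); that is, every solution blows up in finite time. -/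
open Finset

/-- Green's formula for the weighted graph Laplacian. -/
theorem sum_mul_laplacian_eq {V : Type*} [Fintype V] (ω : V → V → ℝ) (hsymm : ∀ x y, ω x y = ω y x)
    (v u : V → ℝ) :
    ∑ x, v x * ∑ y, (u y - u x) * ω x y
      = -(1 / 2) * ∑ x, ∑ y, (v x - v y) * (u x - u y) * ω x y := by
  have hswap : ∑ x, ∑ y, v y * (u x - u y) * ω x y = ∑ x, ∑ y, v x * (u y - u x) * ω x y := by
    rw [Finset.sum_comm]
    refine sum_congr rfl fun x _ => sum_congr rfl fun y _ => ?_
    rw [hsymm]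
  have hsplit : ∑ x, ∑ y, (v x - v y) * (u x - u y) * ω x y
      = -∑ x, ∑ y, v x * (u y - u x) * ω x y - ∑ x, ∑ y, v y * (u x - u y) * ω x y := by
    simp only [← sum_neg_distrib, ← sum_sub_distrib]
    refine sum_congr rfl fun x _ => sum_congr rfl fun y _ => ?_
    ring
  rw [hsplit, hswap]
  simp only [mul_sum, ← mul_assoc]
  ring

theorem hasDerivAt_min_zero_sq (s : ℝ) :
    HasDerivAt (fun r : ℝ => min r 0 ^ 2) (2 * min s 0) s := by
  rcases lt_trichotomy s 0 with hs | rfl | hs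
  · rw [min_eq_left hs.le]
    have h : HasDerivAt (fun r : ℝ => r ^ 2) (2 * s) s := by
      simpa using hasDerivAt_pow 2 s
    refine h.congr_of_eventuallyEq ?_
    filter_upwards [gt_mem_nhds hs] with r hr
    rw [min_eq_left hr.le]
  · rw [hasDerivAt_iff_isLittleO_nhds_zero]
    simp only [zero_add, min_self, mul_zero, smul_zero, sub_zero, ne_eq, OfNat.ofNat_ne_zero,
      not_false_eq_true, zero_pow]
    have h : (fun r : ℝ => min r 0 ^ 2) =O[nhds 0] fun r : ℝ => r ^ 2 := by
      refine Asymptotics.IsBigO.of_bound 1 (Filter.Eventually.of_forall fun r => ?_)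
      rw [Real.norm_of_nonneg (sq_nonneg _), Real.norm_of_nonneg (sq_nonneg _), one_mul]
      rcases le_total r 0 with hr | hr
      · rw [min_eq_left hr]
      · rw [min_eq_right hr]; simpa using sq_nonneg r
    exact h.trans_isLittleO (Asymptotics.isLittleO_pow_id one_lt_two)
  · rw [min_eq_right hs.le, mul_zero]
    refine (hasDerivAt_const s (0 : ℝ)).congr_of_eventuallyEq ?_
    filter_upwards [lt_mem_nhds hs] with r hr
    simp [min_eq_right hr.le]

/-- A nonnegative function with `N' ≤ C N` that vanishes initially vanishes identically. -/
theorem eq_zero_of_hasDerivAt_le_mul {N N' : ℝ → ℝ} {C T : ℝ} (hT : 0 ≤ T)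
    (hc : ContinuousOn N (Set.Icc 0 T)) (hd : ∀ t ∈ Set.Ioo 0 T, HasDerivAt N (N' t) t)
    (hle : ∀ t ∈ Set.Ioo 0 T, N' t ≤ C * N t) (h0 : N 0 = 0) (hnn : 0 ≤ N T) : N T = 0 := by
  have hanti : AntitoneOn (fun t => N t * Real.exp (-C * t)) (Set.Icc 0 T) := by
    refine antitoneOn_of_hasDerivWithinAt_nonpos (convex_Icc 0 T)
      (f' := fun t => (N' t - C * N t) * Real.exp (-C * t)) ?_ ?_ ?_
    · exact hc.mul (by fun_prop)
    · intro t ht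
      rw [interior_Icc] at ht ⊢
      have he : HasDerivAt (fun t => Real.exp (-C * t)) (Real.exp (-C * t) * (-C * 1)) t :=
        ((hasDerivAt_id t).const_mul (-C)).exp
      exact (((hd t ht).mul he).congr_deriv (by ring)).hasDerivWithinAt
    · intro t ht
      rw [interior_Icc] at ht
      exact mul_nonpos_of_nonpos_of_nonneg (by linarith [hle t ht]) (Real.exp_pos _).le
  have h := hanti (Set.left_mem_Icc.2 hT) (Set.right_mem_Icc.2 hT) hT
  simp only [h0, zero_mul] at h
  exact le_antisymm (nonpos_of_mul_nonpos_left h (Real.exp_pos _)) hnn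

/-- Nonnegativity of solutions of the discrete semilinear heat equation with nonnegative data. -/
theorem discrete_heat_nonneg {V : Type*} [Fintype V] (S : Finset V) (ω : V → V → ℝ)
    (hsymm : ∀ x y, ω x y = ω y x) (hnonneg : ∀ x y, 0 ≤ ω x y)
    (f : ℝ → ℝ) (hf : LocallyLipschitz f) (hf0 : f 0 = 0) (u ut : V → ℝ → ℝ)
    (hc : ∀ x, ContinuousOn (u x) (Set.Ici 0))
    (hd : ∀ x, ∀ t : ℝ, 0 < t → HasDerivAt (u x) (ut x t) t)
    (heq : ∀ x ∈ S, ∀ t : ℝ, 0 < t → ut x t = (∑ y, (u y t - u x t) * ω x y) + f (u x t))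
    (hbd : ∀ x ∉ S, ∀ t : ℝ, 0 ≤ t → u x t = 0) (h0 : ∀ x, 0 ≤ u x 0)
    (x : V) {T : ℝ} (hT : 0 ≤ T) : 0 ≤ u x T := by
  have hcT : ∀ x, ContinuousOn (u x) (Set.Icc 0 T) := fun x => (hc x).mono Set.Icc_subset_Ici_self
  obtain ⟨K, hK⟩ : ∃ K, LipschitzOnWith K f (insert 0 (⋃ x, u x '' Set.Icc 0 T)) :=
    LocallyLipschitzOn.exists_lipschitzOnWith_of_compact
      ((isCompact_iUnion fun x => isCompact_Icc.image_of_continuousOn (hcT x)).insert 0)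
      hf.locallyLipschitzOn
  have hfK : ∀ x, ∀ t ∈ Set.Icc 0 T, |f (u x t)| ≤ K * |u x t| := by
    intro x t ht
    have hmem : u x t ∈ insert 0 (⋃ x, u x '' Set.Icc 0 T) :=
      Or.inr (Set.mem_iUnion.2 ⟨x, t, ht, rfl⟩)
    simpa [hf0, Real.dist_eq] using hK.dist_le_mul _ hmem 0 (Or.inl rfl)
  have hzero : ∑ x, min (u x T) 0 ^ 2 = 0 := by
    refine eq_zero_of_hasDerivAt_le_mul (N := fun t => ∑ x, min (u x t) 0 ^ 2)
      (N' := fun t => ∑ x, 2 * min (u x t) 0 * ut x t) (C := 2 * K) hT ?_ ?_ ?_ ?_ ?_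
    · exact continuousOn_finsetSum _ fun x _ => ((hcT x).inf continuousOn_const).pow 2
    · intro t ht
      exact HasDerivAt.fun_sum fun x _ => (hasDerivAt_min_zero_sq (u x t)).comp t (hd x t ht.1)
    · intro t ht
      have hterm : ∀ x, 2 * min (u x t) 0 * ut x t ≤
          2 * (min (u x t) 0 * ∑ y, (u y t - u x t) * ω x y) + 2 * K * min (u x t) 0 ^ 2 := by
        intro x
        by_cases hx : x ∈ S
        · rw [heq x hx t ht.1]
          have hle : min (u x t) 0 * f (u x t) ≤ K * min (u x t) 0 ^ 2 := by
            have h := hfK x t (Set.Ioo_subset_Icc_self ht)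
            rcases le_total (u x t) 0 with hu | hu
            · rw [min_eq_left hu]
              rw [abs_of_nonpos hu] at h
              nlinarith [neg_abs_le (f (u x t))]
            · simp [min_eq_right hu]
          linarith
        · simp [hbd x hx t ht.1.le]
      have hgreen : ∑ x, min (u x t) 0 * ∑ y, (u y t - u x t) * ω x y ≤ 0 := by
        rw [sum_mul_laplacian_eq ω hsymm (fun x => min (u x t) 0) (fun x => u x t)]
        have : 0 ≤ ∑ x, ∑ y, (min (u x t) 0 - min (u y t) 0) * (u x t - u y t) * ω x y := by
          refine sum_nonneg fun x _ => sum_nonneg fun y _ => mul_nonneg ?_ (hnonneg x y)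
          rcases le_total (u x t) (u y t) with h | h
          · exact mul_nonneg_of_nonpos_of_nonpos
              (sub_nonpos.2 (min_le_min_right 0 h)) (sub_nonpos.2 h)
          · exact mul_nonneg (sub_nonneg.2 (min_le_min_right 0 h)) (sub_nonneg.2 h)
        linarith
      calc ∑ x, 2 * min (u x t) 0 * ut x t
          ≤ ∑ x, (2 * (min (u x t) 0 * ∑ y, (u y t - u x t) * ω x y)
              + 2 * K * min (u x t) 0 ^ 2) := sum_le_sum fun x _ => hterm x
        _ = 2 * ∑ x, (min (u x t) 0 * ∑ y, (u y t - u x t) * ω x y)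
              + 2 * K * ∑ x, min (u x t) 0 ^ 2 := by
            rw [sum_add_distrib, mul_sum, mul_sum]
        _ ≤ 2 * K * ∑ x, min (u x t) 0 ^ 2 := by linarith
    · simp [min_eq_right (h0 _)]
    · positivity
  have hx := (sum_eq_zero_iff_of_nonneg fun x _ => sq_nonneg _).1 hzero x (mem_univ x)
  exact min_eq_right_iff.1 (pow_eq_zero_iff two_ne_zero |>.1 hx)

/-- The differential inequalities of the concavity method have no global solution. -/
theorem concavity_no_global_solution {A A' J J' : ℝ → ℝ} {p : ℝ} (hp : 1 < p)
    (hAc : ContinuousOn A (Set.Ici 0)) (hJc : ContinuousOn J (Set.Ici 0))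
    (hAd : ∀ t : ℝ, 0 < t → HasDerivAt A (A' t) t)
    (hJd : ∀ t : ℝ, 0 < t → HasDerivAt J (J' t) t)
    (hA0 : 0 < A 0) (hJ0 : 0 < J 0) (hJ' : ∀ t : ℝ, 0 < t → 0 ≤ J' t)
    (hAJ : ∀ t : ℝ, 0 < t → 4 * p * J t ≤ A' t)
    (hCS : ∀ t : ℝ, 0 < t → A' t ^ 2 ≤ 4 * A t * J' t) : False := by
  have monotone_of {g g' : ℝ → ℝ} (hgc : ContinuousOn g (Set.Ici 0))
      (hg : ∀ t : ℝ, 0 < t → HasDerivAt g (g' t) t) (hg' : ∀ t : ℝ, 0 < t → 0 ≤ g' t)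
      {t : ℝ} (ht : 0 ≤ t) : g 0 ≤ g t :=
    monotoneOn_of_hasDerivWithinAt_nonneg (convex_Ici 0) hgc
      (fun t ht => (hg t (by simpa using ht)).hasDerivWithinAt)
      (fun t ht => hg' t (by simpa using ht)) (Set.self_mem_Ici) ht ht
  have hJpos : ∀ t : ℝ, 0 ≤ t → 0 < J t := fun t ht => hJ0.trans_le (monotone_of hJc hJd hJ' ht)
  have hA'pos : ∀ t : ℝ, 0 < t → 0 < A' t := fun t ht =>
    (by have := hJpos t ht.le; positivity : 0 < 4 * p * J t).trans_le (hAJ t ht)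
  have hApos : ∀ t : ℝ, 0 ≤ t → 0 < A t := fun t ht =>
    hA0.trans_le (monotone_of hAc hAd (fun t ht => (hA'pos t ht).le) ht)
  have hpowc (q : ℝ) : ContinuousOn (fun t => A t ^ q) (Set.Ici 0) :=
    hAc.rpow_const fun t ht => Or.inl (hApos t ht).ne'
  have hpowd (q t : ℝ) (ht : 0 < t) :
      HasDerivAt (fun t => A t ^ q) (A' t * q * A t ^ (q - 1)) t :=
    (hAd t ht).rpow_const (Or.inl (hApos t ht.le).ne')
  have hG : ∀ t : ℝ, 0 ≤ t → J 0 * A 0 ^ (-p) ≤ J t * A t ^ (-p) := by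
    intro t ht
    refine monotone_of (g := fun t => J t * A t ^ (-p)) (hJc.mul (hpowc _))
      (fun s hs => (hJd s hs).mul (hpowd (-p) s hs)) (fun s hs => ?_) ht
    have hsplit : A s ^ (-p) = A s * A s ^ (-p - 1) := by
      rw [← Real.rpow_one_add' (hApos s hs.le).le (by linarith)]; ring_nf
    have hfac : J' s * A s ^ (-p) + J s * (A' s * (-p) * A s ^ (-p - 1))
        = (A s * J' s - p * J s * A' s) * A s ^ (-p - 1) := by rw [hsplit]; ring
    rw [hfac]
    refine mul_nonneg ?_ (Real.rpow_nonneg (hApos s hs.le).le _)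
    nlinarith [hCS s hs, mul_le_mul_of_nonneg_right (hAJ s hs) (hA'pos s hs).le]
  set c := J 0 * A 0 ^ (-p) with hc_def
  have hc : 0 < c := mul_pos hJ0 (Real.rpow_pos_of_pos hA0 _)
  set k := 4 * p * c * (p - 1) with hk_def
  have hk : 0 < k := by have := sub_pos.2 hp; positivity
  have hH : ∀ t : ℝ, 0 ≤ t → k * t < A 0 ^ (1 - p) := by
    intro t ht
    have h := monotone_of (g := fun t => -A t ^ (1 - p) - k * t)
      ((hpowc _).neg.sub (by fun_prop))
      (fun s hs => (hpowd (1 - p) s hs).neg.sub ((hasDerivAt_id s).const_mul k))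
      (fun s hs => by
        have hexp : 1 - p - 1 = -p := by ring
        rw [hexp]
        have h1 : 4 * p * c ≤ A' s * A s ^ (-p) :=
          calc 4 * p * c ≤ 4 * p * (J s * A s ^ (-p)) := by gcongr; exact hG s hs.le
            _ = 4 * p * J s * A s ^ (-p) := by ring
            _ ≤ A' s * A s ^ (-p) := mul_le_mul_of_nonneg_right (hAJ s hs)
                (Real.rpow_nonneg (hApos s hs.le).le _)
        nlinarith) ht
    have := Real.rpow_pos_of_pos (hApos t ht) (1 - p)
    simp only [mul_zero, sub_zero] at h
    linarith
  have h := hH (A 0 ^ (1 - p) / k) (div_nonneg (Real.rpow_nonneg hA0.le _) hk.le)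
  rw [mul_div_cancel₀ _ hk.ne'] at h
  exact h.false

/-- **Concavity method: blow-up under condition (C) (main theorem).**
Network: finite `V = S̄`, nonempty interior `S`, nonempty boundary `Sᶜ`,
symmetric nonnegative weight `ω` vanishing on the diagonal (`x ∼ y` iff
`0 < ω x y`), graph on `S̄` connected.  `λ₀` is the first Dirichlet
eigenvalue, i.e. the minimum of the Rayleigh quotient over nonzero functions
vanishing on `∂S`, and `F u = ∫₀ᵘ f`.  Assume `f` is locally Lipschitz,
`f 0 = 0`, `f > 0` on `(0,∞)`, and condition (C): there are
`α, β, γ > 0` with `β ≤ (α-2)λ₀/2` and `α F(u) ≤ u f(u) + β u² + γ` for all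
`u > 0`.  If `u₀ ≥ 0` vanishes on `∂S`, is positive at some interior vertex,
and `J(u₀) = -(1/4) ∑∑ (u₀x-u₀y)² ω + ∑ (F(u₀x) - γ) > 0`, then there is no
solution of the discrete semilinear heat equation with data `u₀` defined on
all of `[0,∞)`: every solution blows up in finite time. -/
theorem blow_up_concavity {V : Type*} [Fintype V] [DecidableEq V]
    (S : Finset V) (hS : S.Nonempty) (hSc : Sᶜ.Nonempty)
    (ω : V → V → ℝ)
    (hsymm : ∀ x y, ω x y = ω y x)
    (hnonneg : ∀ x y, 0 ≤ ω x y)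
    (hdiag : ∀ x, ω x x = 0)
    (hconn : ∀ x y : V, Relation.ReflTransGen (fun a b => 0 < ω a b) x y)
    (lam : ℝ)
    (hlam : IsLeast {r : ℝ | ∃ w : V → ℝ, (∀ x ∉ S, w x = 0) ∧ w ≠ 0 ∧
        r = ((1 / 2) * ∑ x, ∑ y, (w x - w y) ^ 2 * ω x y) / (∑ x, (w x) ^ 2)} lam)
    (f : ℝ → ℝ) (hf : LocallyLipschitz f) (hf0 : f 0 = 0)
    (hfpos : ∀ s : ℝ, 0 < s → 0 < f s)
    (α β γ : ℝ) (hα : 0 < α) (hβ : 0 < β) (hγ : 0 < γ)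
    (hβle : β ≤ (α - 2) * lam / 2)
    (hC : ∀ s : ℝ, 0 < s → α * (∫ r in (0:ℝ)..s, f r) ≤ s * f s + β * s ^ 2 + γ)
    (u₀ : V → ℝ) (hu₀bd : ∀ x ∉ S, u₀ x = 0)
    (hu₀nn : ∀ x, 0 ≤ u₀ x)
    (xstar : V) (hxstar : xstar ∈ S) (hxpos : 0 < u₀ xstar)
    (hJ0 : 0 < -(1 / 4) * (∑ x, ∑ y, (u₀ x - u₀ y) ^ 2 * ω x y)
        + ∑ x, ((∫ r in (0:ℝ)..(u₀ x), f r) - γ)) :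
    ¬ ∃ u ut : V → ℝ → ℝ,
        (∀ x, ContinuousOn (u x) (Set.Ici 0)) ∧
        (∀ x, ∀ t : ℝ, 0 < t → HasDerivAt (u x) (ut x t) t) ∧
        (∀ x ∈ S, ∀ t : ℝ, 0 < t →
          ut x t = (∑ y, (u y t - u x t) * ω x y) + f (u x t)) ∧
        (∀ x ∉ S, ∀ t : ℝ, 0 ≤ t → u x t = 0) ∧
        (∀ x, u x 0 = u₀ x) := by
  rintro ⟨u, ut, hc, hd, heq, hbd, hinit⟩
  have hnn : ∀ x, ∀ t : ℝ, 0 ≤ t → 0 ≤ u x t := fun x t ht =>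
    discrete_heat_nonneg S ω hsymm hnonneg f hf hf0 u ut hc hd heq hbd
      (fun x => (hinit x).symm ▸ hu₀nn x) x ht
  have hut0 : ∀ x ∉ S, ∀ t : ℝ, 0 < t → ut x t = 0 := fun x hx t ht =>
    (hd x t ht).unique <| (hasDerivAt_const t (0 : ℝ)).congr_of_eventuallyEq <| by
      filter_upwards [lt_mem_nhds ht] with s hs using hbd x hx s hs.le
  have hlam0 : 0 ≤ lam := by
    obtain ⟨w, -, -, rfl⟩ := hlam.1
    exact div_nonneg (mul_nonneg (by norm_num) (sum_nonneg fun x _ => sum_nonneg fun y _ =>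
      mul_nonneg (sq_nonneg _) (hnonneg x y))) (sum_nonneg fun x _ => sq_nonneg _)
  have hα2 : 2 < α := by
    by_contra! h
    nlinarith [mul_nonneg (sub_nonneg.2 h) hlam0]
  have hray : ∀ w : V → ℝ, (∀ x ∉ S, w x = 0) →
      lam * ∑ x, w x ^ 2 ≤ (1 / 2) * ∑ x, ∑ y, (w x - w y) ^ 2 * ω x y := by
    intro w hw
    by_cases hw0 : w = 0
    · simp [hw0]
    · obtain ⟨z, hz⟩ := Function.ne_iff.1 hw0
      have hpos : 0 < ∑ x, w x ^ 2 := sum_pos' (fun x _ => sq_nonneg _)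
        ⟨z, mem_univ z, sq_pos_of_ne_zero hz⟩
      exact (le_div_iff₀ hpos).1 (hlam.2 ⟨w, hw, hw0, rfl⟩)
  have hF : ∀ s : ℝ, HasDerivAt (fun s => ∫ r in (0:ℝ)..s, f r) (f s) s := fun s =>
    (hf.continuous.integral_hasStrictDerivAt 0 s).hasDerivAt
  have hFc : Continuous fun s => ∫ r in (0:ℝ)..s, f r :=
    continuous_iff_continuousAt.2 fun s => (hF s).continuousAt
  have hC' : ∀ s : ℝ, 0 ≤ s → α * (∫ r in (0:ℝ)..s, f r) ≤ s * f s + β * s ^ 2 + γ := by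
    intro s hs
    rcases hs.eq_or_lt with rfl | hs
    · simpa using hγ.le
    · exact hC s hs
  have hutu : ∀ x, ∀ t : ℝ, 0 < t →
      u x t * ut x t = u x t * (∑ y, (u y t - u x t) * ω x y) + u x t * f (u x t) := by
    intro x t ht
    by_cases hx : x ∈ S
    · rw [heq x hx t ht, mul_add]
    · simp [hbd x hx t ht.le]
  have hutut : ∀ x, ∀ t : ℝ, 0 < t →
      ut x t ^ 2 = ut x t * (∑ y, (u y t - u x t) * ω x y) + f (u x t) * ut x t := by
    intro x t ht
    by_cases hx : x ∈ S
    · rw [mul_comm (f _), ← mul_add, ← heq x hx t ht, sq]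
    · simp [hut0 x hx t ht]
  refine concavity_no_global_solution (p := α / 2)
    (A := fun t => ∑ x, u x t ^ 2) (A' := fun t => ∑ x, 2 * (u x t * ut x t))
    (J := fun t => -(1 / 4) * (∑ x, ∑ y, (u x t - u y t) ^ 2 * ω x y)
      + ∑ x, ((∫ r in (0:ℝ)..(u x t), f r) - γ))
    (J' := fun t => ∑ x, ut x t ^ 2) (by linarith) ?_ ?_ ?_ ?_ ?_ ?_ ?_ ?_ ?_
  · exact continuousOn_finsetSum _ fun x _ => (hc x).pow 2
  · refine (continuousOn_const.mul (continuousOn_finsetSum _ fun x _ =>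
      continuousOn_finsetSum _ fun y _ => (((hc x).sub (hc y)).pow 2).mul
        continuousOn_const)).add (continuousOn_finsetSum _ fun x _ =>
          (hFc.comp_continuousOn (hc x)).sub continuousOn_const)
  · intro t ht
    exact HasDerivAt.fun_sum fun x _ => ((hd x t ht).pow 2).congr_deriv (by ring)
  · intro t ht
    have hE := (HasDerivAt.fun_sum (u := univ) fun x _ => HasDerivAt.fun_sum (u := univ) fun y _ =>
      (((hd x t ht).sub (hd y t ht)).pow 2).mul_const (ω x y)).const_mul (-(1 / 4))
    have hΦ := HasDerivAt.fun_sum (u := univ) fun x _ =>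
      ((hF (u x t)).comp t (hd x t ht)).sub_const γ
    refine (hE.add hΦ).congr_deriv ?_
    rw [sum_congr rfl fun x _ => hutut x t ht, sum_add_distrib,
      sum_mul_laplacian_eq ω hsymm (fun x => ut x t) (fun x => u x t)]
    congr 1
    simp only [mul_sum]
    refine sum_congr rfl fun x _ => sum_congr rfl fun y _ => ?_
    simp
    ring
  · simp only [hinit]
    exact sum_pos' (fun x _ => sq_nonneg _) ⟨xstar, mem_univ _, pow_pos hxpos 2⟩
  · simpa only [hinit] using hJ0
  · exact fun t _ => sum_nonneg fun x _ => sq_nonneg _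
  · intro t ht
    simp only [← mul_sum]
    rw [sum_congr rfl fun x _ => hutu x t ht, sum_add_distrib,
      sum_mul_laplacian_eq ω hsymm (fun x => u x t) (fun x => u x t)]
    simp only [← sq]
    have hr := hray (fun x => u x t) fun x hx => hbd x hx t ht.le
    have hsum : α * ∑ x, ((∫ r in (0:ℝ)..(u x t), f r) - γ)
        ≤ ∑ x, u x t * f (u x t) + β * ∑ x, u x t ^ 2 := by
      rw [mul_sum, mul_sum, ← sum_add_distrib]
      refine sum_le_sum fun x _ => ?_
      nlinarith [hC' (u x t) (hnn x t ht.le)]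
    have hA : 0 ≤ ∑ x, u x t ^ 2 := sum_nonneg fun x _ => sq_nonneg _
    have hβA := mul_le_mul_of_nonneg_right hβle hA
    have hrα := mul_le_mul_of_nonneg_left hr (by linarith : 0 ≤ α - 2)
    linarith
  · intro t ht
    have h := sum_mul_sq_le_sq_mul_sq univ (fun x => u x t) (fun x => ut x t)
    simp only [← mul_sum]
    linarith
end

section
/- (Blow-up time estimate) Under the hypotheses of the main theorem (f locally Lipschitz, f(0) = 0, f > 0 on (0,∞), condition (C) with constants α, β, γ > 0 and β ≤ (α−2)λ₀/2, and u₀ ≥ 0 vanishing on ∂S, positive at some interior vertex, with J(u₀) > 0), set ξ = √(α/2) − 1 and M = [α/(α−2)] · (1 + √(1 + (α−2)/2)) · (∑_{x∈S̄} u₀(x)²)² / (2α J(u₀)). Then every solution u of the discrete semilinear heat equation with initial data u₀ defined on [0,T) satisfies T ≤ M / (ξ ∑_{x∈S̄} u₀(x)²). -/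
open Finset

section

open Set Filter Topology

theorem le_of_hasDerivAt_nonneg {b : ℝ} {h h' : ℝ → ℝ} (hc : ContinuousOn h (Icc 0 b))
    (hd : ∀ t ∈ Ioo 0 b, HasDerivAt h (h' t) t) (hnn : ∀ t ∈ Ioo 0 b, 0 ≤ h' t)
    {t : ℝ} (ht : t ∈ Icc 0 b) : h 0 ≤ h t := by
  have hmono : MonotoneOn h (Icc 0 b) := by
    apply monotoneOn_of_hasDerivWithinAt_nonneg (convex_Icc 0 b) hc (f' := h')
    · intro x hx
      exact (hd x (by simpa using hx)).hasDerivWithinAt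
    · intro x hx
      exact hnn x (by simpa using hx)
  exact hmono ⟨le_rfl, ht.1.trans ht.2⟩ ht ht.1

theorem exists_primitive_Icc {b : ℝ} (hb : 0 < b) {g : ℝ → ℝ} (hg : ContinuousOn g (Icc 0 b)) :
    ∃ P : ℝ → ℝ, Continuous P ∧ P 0 = 0 ∧ ∀ t ∈ Ioo 0 b, HasDerivAt P (g t) t := by
  have hG : Continuous (IccExtend hb.le ((Icc 0 b).domRestrict g)) :=
    (continuousOn_iff_continuous_domRestrict.1 hg).Icc_extend'
  have hP : ∀ t, HasDerivAt (fun t => ∫ s in (0 : ℝ)..t, IccExtend hb.le ((Icc 0 b).domRestrict g) s)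
      (IccExtend hb.le ((Icc 0 b).domRestrict g) t) t := fun t =>
    intervalIntegral.integral_hasDerivAt_right (hG.intervalIntegrable _ _)
      (hG.stronglyMeasurableAtFilter _ _) hG.continuousAt
  refine ⟨_, continuous_iff_continuousAt.2 fun t => (hP t).continuousAt, by simp, fun t ht => ?_⟩
  have h := hP t
  rwa [IccExtend_of_mem _ _ (Ioo_subset_Icc_self ht)] at h

/-- Levine's concavity argument: `g` plays the role of `∑ u²` and `J` that of the energy. -/
theorem time_le_of_concavity {b A J₀ ξ : ℝ} (hb : 0 < b) (hA : 0 < A) (hJ₀ : 0 < J₀) (hξ : 0 < ξ)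
    {g g' J J' : ℝ → ℝ} (hg : ContinuousOn g (Icc 0 b)) (hJ : ContinuousOn J (Icc 0 b))
    (hdg : ∀ t ∈ Ioo 0 b, HasDerivAt g (g' t) t) (hdJ : ∀ t ∈ Ioo 0 b, HasDerivAt J (J' t) t)
    (hg0 : g 0 = A) (hJ0 : J 0 = J₀)
    (hgJ : ∀ t ∈ Ioo 0 b, 4 * (1 + ξ) ^ 2 * J t ≤ g' t)
    (hquad : ∀ t ∈ Ioo 0 b, ∀ c : ℝ, 0 ≤ g t * (c * c) + g' t * c + J' t) :
    b ≤ A ^ 2 / (4 * ξ * J₀) / (ξ * A) := by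
  obtain ⟨P, hPc, hP0, hdP⟩ := exists_primitive_Icc hb hg
  have hJge : ∀ t ∈ Icc 0 b, J₀ ≤ J t := fun t ht => by
    rw [← hJ0]
    exact le_of_hasDerivAt_nonneg hJ hdJ (fun s hs => by simpa using hquad s hs 0) ht
  have hgge : ∀ t ∈ Icc 0 b, A ≤ g t := fun t ht => by
    rw [← hg0]
    refine le_of_hasDerivAt_nonneg hg hdg (fun s hs => le_trans ?_ (hgJ s hs)) ht
    have := hJge s (Ioo_subset_Icc_self hs)
    have : 0 < J s := by linarith
    positivity
  have hPnn : ∀ t ∈ Icc 0 b, 0 ≤ P t := fun t ht => by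
    rw [← hP0]
    exact le_of_hasDerivAt_nonneg hPc.continuousOn hdP
      (fun s hs => hA.le.trans (hgge s (Ioo_subset_Icc_self hs))) ht
  have hCS : ∀ t ∈ Icc 0 b, (g t - A) ^ 2 ≤ 4 * P t * (J t - J₀) := fun t ht => by
    have h : ∀ c : ℝ, 0 ≤ P t * (c * c) + (g t - A) * c + (J t - J₀) := fun c => by
      have h0 := le_of_hasDerivAt_nonneg
        (h := fun t => P t * (c * c) + (g t - A) * c + (J t - J₀))
        (h' := fun t => g t * (c * c) + g' t * c + J' t)
        (by fun_prop)
        (fun s hs => (((hdP s hs).mul_const _).add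
          (((hdg s hs).sub_const A).mul_const c)).add ((hdJ s hs).sub_const J₀))
        (fun s hs => hquad s hs c) ht
      simpa [hP0, hg0, hJ0] using h0
    have := discrim_le_zero h
    unfold discrim at this
    linarith
  set M := A ^ 2 / (4 * ξ * J₀) with hM
  have hMpos : 0 < M := by positivity
  have hMeq : 4 * ξ * J₀ * M = A ^ 2 := by rw [hM]; field_simp
  have key : ∀ t ∈ Ioo 0 b, (1 + ξ) * g t ^ 2 ≤ (P t + M) * g' t := fun t ht => by
    have ht' := Ioo_subset_Icc_self ht
    have h1 := hCS t ht'
    have h2 := hPnn t ht'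
    have h3 : (P t + M) * (4 * (1 + ξ) ^ 2 * J t) ≤ (P t + M) * g' t :=
      mul_le_mul_of_nonneg_left (hgJ t ht) (by positivity)
    refine le_trans ?_ h3
    have h4 : 0 ≤ J t - J₀ := by linarith [hJge t ht']
    have h5 : 0 ≤ M * (J t - J₀) := by positivity
    have h6 : 0 ≤ P t * J₀ := by positivity
    have h7 : ξ * g t ^ 2 ≤ (1 + ξ) * (A ^ 2 + ξ * (g t - A) ^ 2) := by
      nlinarith [sq_nonneg (A - ξ * (g t - A))]
    have h8 : ξ * g t ^ 2 ≤ ξ * ((1 + ξ) * (4 * (P t + M) * J t)) := by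
      refine h7.trans ?_
      have : A ^ 2 + ξ * (g t - A) ^ 2 ≤ ξ * (4 * (P t + M) * J t) := by
        rw [← hMeq]
        nlinarith [mul_nonneg hξ.le h5, mul_nonneg hξ.le h6, mul_le_mul_of_nonneg_left h1 hξ.le]
      calc _ ≤ (1 + ξ) * (ξ * (4 * (P t + M) * J t)) :=
            mul_le_mul_of_nonneg_left this (by positivity)
        _ = _ := by ring
    have h9 := le_of_mul_le_mul_left h8 hξ
    calc _ ≤ (1 + ξ) * ((1 + ξ) * (4 * (P t + M) * J t)) :=
          mul_le_mul_of_nonneg_left h9 (by positivity)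
      _ = _ := by ring
  have hbm : b ∈ Icc 0 b := ⟨hb.le, le_rfl⟩
  have hgpos : ∀ t ∈ Icc 0 b, 0 < g t := fun t ht => hA.trans_le (hgge t ht)
  have hfin := le_of_hasDerivAt_nonneg
    (h := fun t => -((P t + M) / g t) - ξ * t)
    (h' := fun t => -((g t * g t - (P t + M) * g' t) / g t ^ 2) - ξ * 1)
    ((((hPc.continuousOn.add continuousOn_const).div hg
      (fun t ht => (hgpos t ht).ne')).neg).sub (by fun_prop))
    (fun s hs => ((((hdP s hs).add_const M).div (hdg s hs)
      (hgpos s (Ioo_subset_Icc_self hs)).ne').neg).sub ((hasDerivAt_id s).const_mul ξ))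
    (fun s hs => by
      have h1 := key s hs
      have h2 := hgpos s (Ioo_subset_Icc_self hs)
      have : (g s * g s - (P s + M) * g' s) / g s ^ 2 ≤ -ξ := by
        rw [div_le_iff₀ (by positivity)]
        linarith
      linarith) hbm
  simp only [hP0, hg0, zero_add, mul_zero, sub_zero] at hfin
  have h1 : 0 < (P b + M) / g b := div_pos (by linarith [hPnn b hbm]) (hgpos b hbm)
  rw [le_div_iff₀ (by positivity)]
  have h2 : ξ * b ≤ M / A := by linarith
  rw [le_div_iff₀ hA] at h2
  linarith

theorem deriv_nonpos_of_isMinOn_Icc {b t d : ℝ} {h : ℝ → ℝ} (ht : t ∈ Ioc 0 b)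
    (hmin : IsMinOn h (Icc 0 b) t) (hd : HasDerivAt h d t) : d ≤ 0 := by
  have hs : Tendsto (slope h t) (𝓝[<] t) (𝓝 d) :=
    (hasDerivAt_iff_tendsto_slope.1 hd).mono_left
      (nhdsWithin_mono _ fun s hs => (ne_of_lt hs : s ≠ t))
  refine le_of_tendsto hs ?_
  filter_upwards [Ioo_mem_nhdsLT ht.1] with s hs
  rw [slope_def_field]
  have : h t ≤ h s := hmin ⟨hs.1.le, hs.2.le.trans ht.2⟩
  exact div_nonpos_of_nonneg_of_nonpos (by linarith) (by linarith [hs.2])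

theorem exists_linear_lower_bound {f : ℝ → ℝ} (hf : LocallyLipschitz f) (hf0 : f 0 = 0) (R : ℝ) :
    ∃ L : ℝ, ∀ s ∈ Icc (-R) 0, L * s ≤ f s := by
  obtain ⟨K, hK⟩ := hf.locallyLipschitzOn.exists_lipschitzOnWith_of_compact
    (isCompact_Icc (a := -R) (b := 0))
  refine ⟨K, fun s hs => ?_⟩
  have h := hK.dist_le_mul s hs 0 ⟨hs.1.trans hs.2, le_rfl⟩
  rw [Real.dist_eq, Real.dist_eq, hf0, sub_zero, sub_zero, abs_of_nonpos hs.2] at h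
  linarith [neg_abs_le (f s)]

/-- Minimum principle. -/
theorem solution_nonneg {V : Type*} [Fintype V] (S : Finset V) {ω : V → V → ℝ}
    (hω : ∀ x y, 0 ≤ ω x y) {f : ℝ → ℝ} (hf : LocallyLipschitz f) (hf0 : f 0 = 0) {b : ℝ}
    {u ut : V → ℝ → ℝ} (hcont : ∀ x, ContinuousOn (u x) (Icc 0 b))
    (hder : ∀ x, ∀ t ∈ Ioc 0 b, HasDerivAt (u x) (ut x t) t)
    (heq : ∀ x ∈ S, ∀ t ∈ Ioc 0 b, ut x t = (∑ y, (u y t - u x t) * ω x y) + f (u x t))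
    (hbdry : ∀ x ∉ S, ∀ t ∈ Icc 0 b, u x t = 0) (hinit : ∀ x, 0 ≤ u x 0)
    (x : V) {t : ℝ} (ht : t ∈ Icc 0 b) : 0 ≤ u x t := by
  have hne : (Icc 0 b).Nonempty := ⟨t, ht⟩
  have : Nonempty V := ⟨x⟩
  choose τ₁ hτ₁ hmin₁ using fun x => isCompact_Icc.exists_isMinOn hne (hcont x)
  obtain ⟨x₁, hx₁⟩ := Finite.exists_min fun x => u x (τ₁ x)
  obtain ⟨L, hL⟩ := exists_linear_lower_bound hf hf0 (-u x₁ (τ₁ x₁))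
  set k : ℝ := L + 1
  choose τ hτ hmin using fun x => isCompact_Icc.exists_isMinOn hne
    (f := fun t => Real.exp (-k * t) * u x t) (ContinuousOn.mul (by fun_prop) (hcont x))
  obtain ⟨x₀, hx₀⟩ := Finite.exists_min fun x => Real.exp (-k * τ x) * u x (τ x)
  set t₀ := τ x₀
  have hglob : ∀ y, ∀ s ∈ Icc 0 b, Real.exp (-k * t₀) * u x₀ t₀ ≤ Real.exp (-k * s) * u y s :=
    fun y s hs => (hx₀ y).trans (hmin y hs)
  by_contra! hneg
  have hneg₀ : u x₀ t₀ < 0 := by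
    have h1 := hglob x t ht
    have h2 : Real.exp (-k * t) * u x t < 0 := mul_neg_of_pos_of_neg (Real.exp_pos _) hneg
    by_contra! h3
    have := mul_nonneg (Real.exp_pos (-k * t₀)).le h3
    linarith
  have hx₀S : x₀ ∈ S := by
    by_contra h
    exact hneg₀.ne (hbdry x₀ h t₀ (hτ x₀))
  have ht₀ : t₀ ∈ Ioc 0 b := by
    refine ⟨lt_of_le_of_ne (hτ x₀).1 fun h => ?_, (hτ x₀).2⟩
    rw [← h] at hneg₀
    exact absurd (hinit x₀) (not_le.2 hneg₀)
  have hd : HasDerivAt (fun t => Real.exp (-k * t) * u x₀ t)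
      (Real.exp (-k * t₀) * (-k * 1) * u x₀ t₀ + Real.exp (-k * t₀) * ut x₀ t₀) t₀ :=
    (((hasDerivAt_id t₀).const_mul (-k)).exp).mul (hder x₀ t₀ ht₀)
  have hle := deriv_nonpos_of_isMinOn_Icc ht₀ (hmin x₀) hd
  have hle' : ut x₀ t₀ ≤ k * u x₀ t₀ := by
    have : Real.exp (-k * t₀) * (ut x₀ t₀ - k * u x₀ t₀) ≤ 0 := by linarith
    by_contra! h
    exact absurd (mul_pos (Real.exp_pos (-k * t₀)) (sub_pos.2 h)) (not_lt.2 this)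
  have hsum : 0 ≤ ∑ y, (u y t₀ - u x₀ t₀) * ω x₀ y := Finset.sum_nonneg fun y _ =>
    mul_nonneg (sub_nonneg.2 (le_of_mul_le_mul_left (hglob y t₀ (hτ x₀)) (Real.exp_pos _))) (hω _ _)
  have hlow := hL (u x₀ t₀)
    ⟨by rw [neg_neg]; exact (hx₁ x₀).trans (hmin₁ x₀ (hτ x₀)), hneg₀.le⟩
  rw [heq x₀ hx₀S t₀ ht₀] at hle'
  simp only [k] at hle'
  linarith

/-- Summation by parts. -/
theorem sum_laplacian_mul {V : Type*} [Fintype V] {ω : V → V → ℝ}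
    (hsymm : ∀ x y, ω x y = ω y x) (v w : V → ℝ) :
    ∑ x, w x * ∑ y, (v y - v x) * ω x y
      = -(1 / 2) * ∑ x, ∑ y, (v x - v y) * (w x - w y) * ω x y := by
  have h1 : ∑ x, w x * ∑ y, (v y - v x) * ω x y = ∑ x, ∑ y, w x * ((v y - v x) * ω x y) := by
    simp_rw [Finset.mul_sum]
  have h2 : ∑ x, ∑ y, w x * ((v y - v x) * ω x y) = ∑ x, ∑ y, w y * ((v x - v y) * ω x y) := by
    rw [Finset.sum_comm]
    refine Finset.sum_congr rfl fun x _ => Finset.sum_congr rfl fun y _ => ?_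
    rw [hsymm]
  have h3 : ∑ x, ∑ y, (v x - v y) * (w x - w y) * ω x y
      = -(∑ x, ∑ y, w x * ((v y - v x) * ω x y))
        - ∑ x, ∑ y, w y * ((v x - v y) * ω x y) := by
    simp_rw [← Finset.sum_neg_distrib, ← Finset.sum_sub_distrib]
    refine Finset.sum_congr rfl fun x _ => Finset.sum_congr rfl fun y _ => ?_
    ring
  rw [h3, ← h2, h1]
  ring

theorem hasDerivAt_energy {V : Type*} [Fintype V] {ω : V → V → ℝ}
    (hsymm : ∀ x y, ω x y = ω y x) {f : ℝ → ℝ} (hf : Continuous f) (γ : ℝ)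
    {u : V → ℝ → ℝ} {u' : V → ℝ} {t : ℝ} (hu : ∀ x, HasDerivAt (u x) (u' x) t) :
    HasDerivAt (fun t => -(1 / 4) * (∑ x, ∑ y, (u x t - u y t) ^ 2 * ω x y)
        + ∑ x, ((∫ r in (0:ℝ)..(u x t), f r) - γ))
      (∑ x, u' x * ((∑ y, (u y t - u x t) * ω x y) + f (u x t))) t := by
  have hF : ∀ x, HasDerivAt (fun t => (∫ r in (0:ℝ)..(u x t), f r) - γ) (f (u x t) * u' x) t :=
    fun x => ((intervalIntegral.integral_hasDerivAt_right (hf.intervalIntegrable _ _)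
      (hf.stronglyMeasurableAtFilter _ _) hf.continuousAt).comp t (hu x)).sub_const γ
  have hE : HasDerivAt (fun t => ∑ x, ∑ y, (u x t - u y t) ^ 2 * ω x y)
      (∑ x, ∑ y, (((2 : ℕ) : ℝ) * (u x t - u y t) ^ (2 - 1) * (u' x - u' y)) * ω x y) t :=
    HasDerivAt.fun_sum fun x _ => HasDerivAt.fun_sum fun y _ =>
      (((hu x).sub (hu y)).pow 2).mul_const _
  refine ((hE.const_mul (-(1 / 4))).add (HasDerivAt.fun_sum fun x _ => hF x)).congr_deriv ?_
  simp_rw [mul_add, Finset.sum_add_distrib]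
  rw [sum_laplacian_mul hsymm (fun x => u x t) u']
  congr 1
  · simp_rw [Finset.mul_sum]
    refine Finset.sum_congr rfl fun x _ => Finset.sum_congr rfl fun y _ => ?_
    push_cast
    ring
  · exact Finset.sum_congr rfl fun x _ => mul_comm _ _

/-- Condition (C) together with the Rayleigh bound makes `2 α J` a lower bound for the derivative
of `∑ u²` along the flow. -/
theorem two_mul_energy_le {V : Type*} [Fintype V] {ω : V → V → ℝ}
    (hsymm : ∀ x y, ω x y = ω y x) {lam α β γ : ℝ} {f : ℝ → ℝ} (hα : 2 < α) (hγ : 0 < γ)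
    (hβle : β ≤ (α - 2) * lam / 2)
    (hC : ∀ s : ℝ, 0 < s → α * (∫ r in (0:ℝ)..s, f r) ≤ s * f s + β * s ^ 2 + γ)
    {w : V → ℝ} (hw : ∀ x, 0 ≤ w x)
    (hray : lam * ∑ x, w x ^ 2 ≤ (1 / 2) * ∑ x, ∑ y, (w x - w y) ^ 2 * ω x y) :
    2 * α * (-(1 / 4) * (∑ x, ∑ y, (w x - w y) ^ 2 * ω x y)
        + ∑ x, ((∫ r in (0:ℝ)..(w x), f r) - γ))
      ≤ 2 * ∑ x, w x * ((∑ y, (w y - w x) * ω x y) + f (w x)) := by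
  have hpt : ∀ x, α * ((∫ r in (0:ℝ)..(w x), f r) - γ) ≤ w x * f (w x) + β * w x ^ 2 := fun x => by
    rcases (hw x).eq_or_lt with h | h
    · simp [← h]
      positivity
    · nlinarith [hC _ h]
  have hsum := Finset.sum_le_sum fun x (_ : x ∈ Finset.univ) => hpt x
  rw [← Finset.mul_sum, Finset.sum_add_distrib, ← Finset.mul_sum] at hsum
  have hN : 0 ≤ ∑ x, w x ^ 2 := Finset.sum_nonneg fun x _ => sq_nonneg _
  simp_rw [mul_add, Finset.sum_add_distrib]
  rw [sum_laplacian_mul hsymm w w]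
  have hE : ∑ x, ∑ y, (w x - w y) * (w x - w y) * ω x y = ∑ x, ∑ y, (w x - w y) ^ 2 * ω x y := by
    simp_rw [sq]
  rw [hE]
  have h1 := mul_le_mul_of_nonneg_left hray (sub_pos.2 hα).le
  have h2 := mul_le_mul_of_nonneg_right hβle hN
  linarith

theorem rayleigh_le {V : Type*} [Fintype V] {S : Finset V} {ω : V → V → ℝ} {lam : ℝ}
    (hlam : IsLeast {r : ℝ | ∃ w : V → ℝ, (∀ x ∉ S, w x = 0) ∧ w ≠ 0 ∧
        r = ((1 / 2) * ∑ x, ∑ y, (w x - w y) ^ 2 * ω x y) / (∑ x, (w x) ^ 2)} lam)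
    {w : V → ℝ} (hw : ∀ x ∉ S, w x = 0) :
    lam * ∑ x, w x ^ 2 ≤ (1 / 2) * ∑ x, ∑ y, (w x - w y) ^ 2 * ω x y := by
  by_cases h0 : w = 0
  · simp [h0]
  · obtain ⟨x, hx⟩ := Function.ne_iff.1 h0
    have hpos : 0 < ∑ x, w x ^ 2 := Finset.sum_pos' (fun x _ => sq_nonneg _)
      ⟨x, Finset.mem_univ x, by have : w x ≠ 0 := hx; positivity⟩
    exact (le_div_iff₀ hpos).1 (hlam.2 ⟨w, hw, h0, rfl⟩)

end

/-- **Blow-up time estimate (Remark after the main theorem).**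
Same setting as the main theorem: network (finite `V = S̄`, nonempty interior
`S`, nonempty boundary `Sᶜ`, symmetric nonnegative weight `ω` vanishing on
the diagonal, graph on `S̄` connected), `λ₀` the first Dirichlet eigenvalue
(minimum of the Rayleigh quotient), `F u = ∫₀ᵘ f`, `f` locally Lipschitz with
`f 0 = 0`, `f > 0` on `(0,∞)`, condition (C) with constants `α, β, γ > 0`,
`β ≤ (α-2)λ₀/2`, and `u₀ ≥ 0` vanishing on `∂S`, positive at some interior
vertex, with `J(u₀) > 0`.  Set `ξ = √(α/2) - 1` and
`M = [α/(α-2)]·(1 + √(1 + (α-2)/2))·(∑ u₀²)² / (2α J(u₀))`.  Then every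
solution `u` of the equation with data `u₀` defined on `[0,T)` (`T ∈ (0,∞]`)
satisfies `T ≤ M / (ξ ∑ u₀²)`. -/
theorem blow_up_time_estimate {V : Type*} [Fintype V] [DecidableEq V]
    (S : Finset V) (hS : S.Nonempty) (hSc : Sᶜ.Nonempty)
    (ω : V → V → ℝ)
    (hsymm : ∀ x y, ω x y = ω y x)
    (hnonneg : ∀ x y, 0 ≤ ω x y)
    (hdiag : ∀ x, ω x x = 0)
    (hconn : ∀ x y : V, Relation.ReflTransGen (fun a b => 0 < ω a b) x y)
    (lam : ℝ)
    (hlam : IsLeast {r : ℝ | ∃ w : V → ℝ, (∀ x ∉ S, w x = 0) ∧ w ≠ 0 ∧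
        r = ((1 / 2) * ∑ x, ∑ y, (w x - w y) ^ 2 * ω x y) / (∑ x, (w x) ^ 2)} lam)
    (f : ℝ → ℝ) (hf : LocallyLipschitz f) (hf0 : f 0 = 0)
    (hfpos : ∀ s : ℝ, 0 < s → 0 < f s)
    (α β γ : ℝ) (hα : 0 < α) (hβ : 0 < β) (hγ : 0 < γ)
    (hβle : β ≤ (α - 2) * lam / 2)
    (hC : ∀ s : ℝ, 0 < s → α * (∫ r in (0:ℝ)..s, f r) ≤ s * f s + β * s ^ 2 + γ)
    (u₀ : V → ℝ) (hu₀bd : ∀ x ∉ S, u₀ x = 0)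
    (hu₀nn : ∀ x, 0 ≤ u₀ x)
    (xstar : V) (hxstar : xstar ∈ S) (hxpos : 0 < u₀ xstar)
    (J₀ : ℝ)
    (hJ₀def : J₀ = -(1 / 4) * (∑ x, ∑ y, (u₀ x - u₀ y) ^ 2 * ω x y)
        + ∑ x, ((∫ r in (0:ℝ)..(u₀ x), f r) - γ))
    (hJ0 : 0 < J₀)
    (ξ M : ℝ)
    (hξ : ξ = Real.sqrt (α / 2) - 1)
    (hM : M = (α / (α - 2)) * (1 + Real.sqrt (1 + (α - 2) / 2))
        * (∑ x, (u₀ x) ^ 2) ^ 2 / (2 * α * J₀))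
    (T : EReal) (hT : 0 < T)
    (u ut : V → ℝ → ℝ)
    (hcont : ∀ x, ContinuousOn (u x) {t : ℝ | 0 ≤ t ∧ (t : EReal) < T})
    (hder : ∀ x, ∀ t : ℝ, 0 < t → (t : EReal) < T → HasDerivAt (u x) (ut x t) t)
    (heq : ∀ x ∈ S, ∀ t : ℝ, 0 < t → (t : EReal) < T →
      ut x t = (∑ y, (u y t - u x t) * ω x y) + f (u x t))
    (hbdry : ∀ x ∉ S, ∀ t : ℝ, 0 ≤ t → (t : EReal) < T → u x t = 0)
    (hinit : ∀ x, u x 0 = u₀ x) :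
    T ≤ ((M / (ξ * ∑ x, (u₀ x) ^ 2) : ℝ) : EReal) := by
  have hray : ∀ {w : V → ℝ}, (∀ x ∉ S, w x = 0) →
      lam * ∑ x, w x ^ 2 ≤ (1 / 2) * ∑ x, ∑ y, (w x - w y) ^ 2 * ω x y := rayleigh_le hlam
  have hlam0 : 0 ≤ lam := by
    obtain ⟨w, -, -, hr⟩ := hlam.1
    rw [hr]
    have : 0 ≤ ∑ x, ∑ y, (w x - w y) ^ 2 * ω x y := Finset.sum_nonneg fun x _ =>
      Finset.sum_nonneg fun y _ => mul_nonneg (sq_nonneg _) (hnonneg x y)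
    have : 0 ≤ ∑ x, w x ^ 2 := Finset.sum_nonneg fun x _ => sq_nonneg _
    positivity
  have hα2 : 2 < α := by
    by_contra! h
    nlinarith
  have hA : 0 < ∑ x, u₀ x ^ 2 := Finset.sum_pos' (fun x _ => sq_nonneg _)
    ⟨xstar, Finset.mem_univ _, by positivity⟩
  have hξ1 : 1 + ξ = Real.sqrt (α / 2) := by rw [hξ]; ring
  have hξsq : (1 + ξ) ^ 2 = α / 2 := by rw [hξ1]; exact Real.sq_sqrt (by positivity)
  have hξpos : 0 < ξ := by
    have h0 : 0 ≤ 1 + ξ := hξ1 ▸ Real.sqrt_nonneg _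
    nlinarith
  have hαξ : α = 2 * (1 + ξ) ^ 2 := by rw [hξsq]; ring
  have hMeq : M = (∑ x, u₀ x ^ 2) ^ 2 / (4 * ξ * J₀) := by
    rw [hM, show 1 + (α - 2) / 2 = α / 2 by ring, ← hξ1]
    have h1 : α - 2 = 2 * ξ * (2 + ξ) := by rw [hαξ]; ring
    rw [h1]
    have h2 : 0 < 2 + ξ := by linarith
    field_simp
    ring
  by_contra! hlt
  obtain ⟨b, hbC, hbT⟩ := EReal.lt_iff_exists_real_btwn.1 (max_lt hlt hT)
  obtain ⟨hCb, hb⟩ := max_lt_iff.1 hbC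
  rw [EReal.coe_lt_coe_iff] at hCb
  have hb : 0 < b := by exact_mod_cast hb
  refine not_le.2 hCb ?_
  have hlt : ∀ t : ℝ, t ≤ b → (t : EReal) < T := fun t ht =>
    (EReal.coe_le_coe_iff.2 ht).trans_lt hbT
  have hcont' : ∀ x, ContinuousOn (u x) (Set.Icc 0 b) := fun x =>
    (hcont x).mono fun t ht => ⟨ht.1, hlt t ht.2⟩
  have hnn : ∀ x, ∀ t ∈ Set.Icc 0 b, 0 ≤ u x t := fun x t ht =>
    solution_nonneg S hnonneg hf hf0 hcont' (fun x t ht => hder x t ht.1 (hlt t ht.2))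
      (fun x hx t ht => heq x hx t ht.1 (hlt t ht.2))
      (fun x hx t ht => hbdry x hx t ht.1 (hlt t ht.2)) (fun x => by rw [hinit]; exact hu₀nn x) x ht
  have hder' : ∀ t ∈ Set.Ioo 0 b, ∀ x, HasDerivAt (u x) (ut x t) t := fun t ht x =>
    hder x t ht.1 (hlt t ht.2.le)
  have hut : ∀ t ∈ Set.Ioo 0 b, ∀ x ∉ S, ut x t = 0 := fun t ht x hx => by
    refine (hder' t ht x).unique ((hasDerivAt_const t (0 : ℝ)).congr_of_eventuallyEq ?_)
    filter_upwards [Ioo_mem_nhds ht.1 ht.2] with s hs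
    exact hbdry x hx s hs.1.le (hlt s hs.2.le)
  have hflow : ∀ t ∈ Set.Ioo 0 b, ∀ x (c : ℝ), (x ∉ S → c = 0) →
      c * ((∑ y, (u y t - u x t) * ω x y) + f (u x t)) = c * ut x t := fun t ht x c hc => by
    by_cases hx : x ∈ S
    · rw [heq x hx t ht.1 (hlt t ht.2.le)]
    · simp [hc hx]
  have hfc : Continuous f := hf.continuous
  have hFc : Continuous fun s => ∫ r in (0:ℝ)..s, f r :=
    intervalIntegral.continuous_primitive (fun _ _ => hfc.intervalIntegrable _ _) 0
  rw [hMeq]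
  refine time_le_of_concavity hb hA hJ0 hξpos (g := fun t => ∑ x, u x t ^ 2)
    (g' := fun t => 2 * ∑ x, u x t * ut x t)
    (J := fun t => -(1 / 4) * (∑ x, ∑ y, (u x t - u y t) ^ 2 * ω x y)
        + ∑ x, ((∫ r in (0:ℝ)..(u x t), f r) - γ))
    (J' := fun t => ∑ x, ut x t ^ 2) (by fun_prop) ?_ (fun t ht => ?_) (fun t ht => ?_)
    (by simp only [hinit]) (by simp only [hinit, hJ₀def]) (fun t ht => ?_) (fun t ht c => ?_)
  · have : ∀ x, ContinuousOn (fun t => ∫ r in (0:ℝ)..(u x t), f r) (Set.Icc 0 b) := fun x =>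
      hFc.comp_continuousOn (hcont' x)
    fun_prop
  · refine (HasDerivAt.fun_sum fun x _ => (hder' t ht x).pow 2).congr_deriv ?_
    rw [Finset.mul_sum]
    refine Finset.sum_congr rfl fun x _ => ?_
    push_cast
    ring
  · refine (hasDerivAt_energy hsymm hfc γ (hder' t ht)).congr_deriv ?_
    refine Finset.sum_congr rfl fun x _ => ?_
    rw [hflow t ht x _ (hut t ht x), sq]
  · have ht' := Set.Ioo_subset_Icc_self ht
    have h := two_mul_energy_le hsymm hα2 hγ hβle hC (w := fun x => u x t)
      (fun x => hnn x t ht') (hray fun x hx => hbdry x hx t ht'.1 (hlt t ht'.2))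
    rw [Finset.sum_congr rfl fun x _ => hflow t ht x (u x t)
      fun hx => hbdry x hx t ht'.1 (hlt t ht'.2)] at h
    rwa [show 4 * (1 + ξ) ^ 2 = 2 * α by rw [hαξ]; ring]
  · have h : (∑ x, u x t ^ 2) * (c * c) + 2 * (∑ x, u x t * ut x t) * c + ∑ x, ut x t ^ 2
        = ∑ x, (c * u x t + ut x t) ^ 2 := by
      rw [Finset.sum_mul, Finset.mul_sum, Finset.sum_mul, ← Finset.sum_add_distrib,
        ← Finset.sum_add_distrib]
      exact Finset.sum_congr rfl fun x _ => by ring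
    rw [h]
    exact Finset.sum_nonneg fun x _ => sq_nonneg _
end

section
/- (Energy identity) Let f : ℝ → ℝ be continuous and locally Lipschitz, γ ∈ ℝ, and let u be a solution of the discrete semilinear heat equation on [0,T). Define J(t) = −(1/4) ∑_{x,y∈S̄} [u(x,t) − u(y,t)]² ω(x,y) + ∑_{x∈S̄} [F(u(x,t)) − γ]. Then J is differentiable on (0,T) and J'(t) = ∑_{x∈S̄} (u_t(x,t))² for every t ∈ (0,T). -/
open Finset

/-- Green's identity for the discrete Laplacian of a symmetric weight. -/
theorem sum_sum_sub_mul_sub_mul_weight {V : Type*} [Fintype V] (ω : V → V → ℝ)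
    (hsymm : ∀ x y, ω x y = ω y x) (a b : V → ℝ) :
    ∑ x, ∑ y, (a x - a y) * (b x - b y) * ω x y =
      -2 * ∑ x, (∑ y, (a y - a x) * ω x y) * b x := by
  have hsplit : ∑ x, ∑ y, (a x - a y) * (b x - b y) * ω x y =
      ∑ x, ∑ y, (a x - a y) * b x * ω x y - ∑ x, ∑ y, (a x - a y) * b y * ω x y := by
    simp only [← Finset.sum_sub_distrib]
    exact Finset.sum_congr rfl fun x _ => Finset.sum_congr rfl fun y _ => by ring
  have hswap : ∑ x, ∑ y, (a x - a y) * b y * ω x y =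
      -∑ x, ∑ y, (a x - a y) * b x * ω x y := by
    rw [Finset.sum_comm]
    simp only [← Finset.sum_neg_distrib]
    exact Finset.sum_congr rfl fun x _ => Finset.sum_congr rfl fun y _ => by
      rw [hsymm y x]; ring
  rw [hsplit, hswap, sub_neg_eq_add, ← two_mul, neg_mul, ← mul_neg, ← Finset.sum_neg_distrib]
  congr 1
  refine Finset.sum_congr rfl fun x _ => ?_
  rw [Finset.sum_mul, ← Finset.sum_neg_distrib]
  exact Finset.sum_congr rfl fun y _ => by ring

/-- **Energy identity: `J'(t) = ∑ u_t²`.**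
Network: finite `V = S̄`, nonempty interior `S`, nonempty boundary `Sᶜ`,
symmetric nonnegative weight `ω` vanishing on the diagonal.  Let `f` be
continuous and locally Lipschitz, `γ ∈ ℝ`, `F u = ∫₀ᵘ f`, and let `u` (with
time derivative `ut`) be a solution of `u_t = Δ_ω u + f(u)` on `S × (0,T)`,
`u = 0` on `∂S × [0,T)`, `u(·,0) = u₀`, where `T ∈ (0,∞]`.  Define
`J(t) = -(1/4) ∑∑ (u(x,t)-u(y,t))² ω(x,y) + ∑ (F(u(x,t)) - γ)`.
Then `J` is differentiable on `(0,T)` with `J'(t) = ∑ x, (u_t(x,t))²`. -/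
theorem energy_identity {V : Type*} [Fintype V] [DecidableEq V]
    (S : Finset V) (hS : S.Nonempty) (hSc : Sᶜ.Nonempty)
    (ω : V → V → ℝ)
    (hsymm : ∀ x y, ω x y = ω y x)
    (hnonneg : ∀ x y, 0 ≤ ω x y)
    (hdiag : ∀ x, ω x x = 0)
    (T : EReal) (hT : 0 < T)
    (f : ℝ → ℝ) (hfc : Continuous f) (hf : LocallyLipschitz f)
    (γ : ℝ)
    (u₀ : V → ℝ) (hu₀bd : ∀ x ∉ S, u₀ x = 0)
    (u ut : V → ℝ → ℝ)
    (hcont : ∀ x, ContinuousOn (u x) {t : ℝ | 0 ≤ t ∧ (t : EReal) < T})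
    (hder : ∀ x, ∀ t : ℝ, 0 < t → (t : EReal) < T → HasDerivAt (u x) (ut x t) t)
    (heq : ∀ x ∈ S, ∀ t : ℝ, 0 < t → (t : EReal) < T →
      ut x t = (∑ y, (u y t - u x t) * ω x y) + f (u x t))
    (hbdry : ∀ x ∉ S, ∀ t : ℝ, 0 ≤ t → (t : EReal) < T → u x t = 0)
    (hinit : ∀ x, u x 0 = u₀ x) :
    ∀ t : ℝ, 0 < t → (t : EReal) < T →
      HasDerivAt
        (fun s : ℝ => -(1 / 4) * (∑ x, ∑ y, (u x s - u y s) ^ 2 * ω x y)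
          + ∑ x, ((∫ r in (0:ℝ)..(u x s), f r) - γ))
        (∑ x, (ut x t) ^ 2) t := by
  intro t ht htT
  have hut : ∀ x ∉ S, ut x t = 0 := by
    intro x hx
    have hzero : u x =ᶠ[nhds t] fun _ => 0 := by
      filter_upwards [lt_mem_nhds ht,
        (isOpen_Iio.preimage continuous_coe_real_ereal).mem_nhds htT] with s hs hsT
      exact hbdry x hx s hs.le hsT
    exact (hder x t ht htT).unique ((hasDerivAt_const t (0 : ℝ)).congr_of_eventuallyEq hzero)
  have hdirichlet : HasDerivAt (fun s : ℝ => ∑ x, ∑ y, (u x s - u y s) ^ 2 * ω x y)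
      (∑ x, ∑ y, 2 * ((u x t - u y t) * (ut x t - ut y t) * ω x y)) t := by
    refine HasDerivAt.fun_sum fun x _ => HasDerivAt.fun_sum fun y _ => ?_
    refine ((((hder x t ht htT).fun_sub (hder y t ht htT)).fun_pow 2).mul_const
      (ω x y)).congr_deriv ?_
    push_cast
    ring
  have hpotential : HasDerivAt (fun s : ℝ => ∑ x, ((∫ r in (0 : ℝ)..(u x s), f r) - γ))
      (∑ x, f (u x t) * ut x t) t := by
    refine HasDerivAt.fun_sum fun x _ => HasDerivAt.sub_const γ ?_
    exact (hfc.integral_hasStrictDerivAt 0 (u x t)).hasDerivAt.comp t (hder x t ht htT)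
  refine ((hdirichlet.const_mul (-(1 / 4))).fun_add hpotential).congr_deriv ?_
  simp only [← Finset.mul_sum]
  rw [sum_sum_sub_mul_sub_mul_weight ω hsymm (fun x => u x t) (fun x => ut x t)]
  have hsq : ∑ x, ut x t ^ 2 =
      ∑ x, (∑ y, (u y t - u x t) * ω x y) * ut x t + ∑ x, f (u x t) * ut x t := by
    rw [← Finset.sum_add_distrib]
    refine Finset.sum_congr rfl fun x _ => ?_
    by_cases hx : x ∈ S
    · rw [← add_mul, ← heq x hx t ht htT, sq]
    · simp [hut x hx]
  rw [hsq]
  ring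
end

section
/- Let f : ℝ → ℝ be continuous with F(u) = ∫₀^u f(s) ds, and let ε, β, γ > 0. Then the inequality (2+ε) F(u) ≤ u f(u) + β u² + γ holds for all u > 0 if and only if the function G(u) = F(u)/u^{2+ε} − (γ/(2+ε)) u^{−(2+ε)} − (β/ε) u^{−ε} is nondecreasing on (0,∞). -/
open Finset

/-- The derivative of `u ↦ F(u)/u^{2+ε} - (γ/(2+ε)) u^{-(2+ε)} - (β/ε) u^{-ε}`, factored through
the defect `u f(u) + β u² + γ - (2+ε) F(u)`. -/
lemma hasDerivAt_div_rpow_sub_sub {f F : ℝ → ℝ} {ε u : ℝ} (β γ : ℝ) (hε : 0 < ε) (hu : 0 < u)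
    (hF : HasDerivAt F (f u) u) :
    HasDerivAt
      (fun u : ℝ => F u / u ^ (2 + ε) - (γ / (2 + ε)) * u ^ (-(2 + ε)) - (β / ε) * u ^ (-ε))
      (u ^ (-(3 + ε)) * (u * f u + β * u ^ 2 + γ - (2 + ε) * F u)) u := by
  have hpow (p : ℝ) : HasDerivAt (fun x : ℝ => x ^ p) (p * u ^ (p - 1)) u :=
    Real.hasDerivAt_rpow_const (Or.inl hu.ne')
  have hquot : HasDerivAt (fun u : ℝ => F u / u ^ (2 + ε))
      (f u * u ^ (-(2 + ε)) + F u * (-(2 + ε) * u ^ (-(2 + ε) - 1))) u := by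
    refine (hF.mul (hpow (-(2 + ε)))).congr_of_eventuallyEq ?_
    filter_upwards [lt_mem_nhds hu] with x hx
    rw [Pi.mul_apply, Real.rpow_neg hx.le, div_eq_mul_inv]
  refine ((hquot.sub ((hpow (-(2 + ε))).const_mul (γ / (2 + ε)))).sub
    ((hpow (-ε)).const_mul (β / ε))).congr_deriv ?_
  have h₁ : u ^ (-(2 + ε)) = u ^ (-(3 + ε)) * u := by
    rw [← Real.rpow_add_one hu.ne']; ring_nf
  have h₂ : u ^ (-ε - 1) = u ^ (-(3 + ε)) * u ^ 2 := by
    rw [← Real.rpow_add_natCast hu.ne']; push_cast; ring_nf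
  have h₃ : -(2 + ε) - 1 = -(3 + ε) := by ring
  rw [h₁, h₂, h₃]
  field_simp
  ring

/-- **Condition (C) as a monotonicity statement.**
Let `f : ℝ → ℝ` be continuous, `F u = ∫₀ᵘ f`, and `ε, β, γ > 0`.  Then
`(2+ε) F(u) ≤ u f(u) + β u² + γ` for all `u > 0` if and only if
`G(u) = F(u)/u^{2+ε} - (γ/(2+ε)) u^{-(2+ε)} - (β/ε) u^{-ε}` is nondecreasing
on `(0,∞)`. -/
theorem conditionC_iff_monotone
    (f : ℝ → ℝ) (hf : Continuous f)
    (ε β γ : ℝ) (hε : 0 < ε) (hβ : 0 < β) (hγ : 0 < γ) :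
    (∀ u : ℝ, 0 < u →
        (2 + ε) * (∫ s in (0:ℝ)..u, f s) ≤ u * f u + β * u ^ 2 + γ) ↔
      MonotoneOn
        (fun u : ℝ => (∫ s in (0:ℝ)..u, f s) / u ^ (2 + ε)
          - (γ / (2 + ε)) * u ^ (-(2 + ε)) - (β / ε) * u ^ (-ε))
        (Set.Ioi 0) := by
  have hG (u : ℝ) (hu : 0 < u) := hasDerivAt_div_rpow_sub_sub β γ hε hu
    (hf.integral_hasStrictDerivAt 0 u).hasDerivAt
  constructor
  · intro h
    refine monotoneOn_of_deriv_nonneg (convex_Ioi 0)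
      (fun u hu => (hG u hu).continuousAt.continuousWithinAt) ?_ ?_
    · rw [interior_Ioi]
      exact fun u hu => (hG u hu).differentiableAt.differentiableWithinAt
    · rw [interior_Ioi]
      intro u hu
      rw [(hG u hu).deriv]
      exact mul_nonneg (Real.rpow_nonneg (le_of_lt hu) _) (sub_nonneg.2 (h u hu))
  · intro h u hu
    have hderiv := h.derivWithin_nonneg (x := u)
    rw [derivWithin_of_isOpen isOpen_Ioi hu, (hG u hu).deriv] at hderiv
    exact sub_nonneg.1 (nonneg_of_mul_nonneg_right hderiv (Real.rpow_pos_of_pos hu _))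
end

section
/- Let f : ℝ → ℝ be continuous with f(u) > 0 for all u > 0, F(u) = ∫₀^u f(s) ds, and let ε > 0. Then the inequality (2+ε) F(u) ≤ u f(u) holds for all u > 0 (condition (A)) if and only if there exists a nondecreasing nonnegative function h : (0,∞) → ℝ such that F(u) = u^{2+ε} h(u) for all u > 0. -/
open Finset

theorem hasDerivAt_mul_rpow_neg {F : ℝ → ℝ} {F' u : ℝ} (p : ℝ) (hF : HasDerivAt F F' u)
    (hu : 0 < u) :
    HasDerivAt (fun x => F x * x ^ (-p)) (u ^ (-p - 1) * (u * F' - p * F u)) u := by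
  refine (hF.mul (Real.hasDerivAt_rpow_const (p := -p) (Or.inl hu.ne'))).congr_deriv ?_
  have h : u ^ (-p) = u ^ (-p - 1) * u := by
    rw [← Real.rpow_add_one hu.ne', sub_add_cancel]
  rw [h]
  ring

/-- On `(0, ∞)`, the quotient `F x / x ^ p` is nondecreasing if and only if `p * F ≤ u * F'`. -/
theorem monotoneOn_mul_rpow_neg_iff {F F' : ℝ → ℝ} (p : ℝ)
    (hF : ∀ u, 0 < u → HasDerivAt F (F' u) u) :
    MonotoneOn (fun x => F x * x ^ (-p)) (Set.Ioi 0) ↔ ∀ u, 0 < u → p * F u ≤ u * F' u := by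
  have hd := fun u hu => hasDerivAt_mul_rpow_neg p (hF u hu) hu
  constructor
  · intro hmono u hu
    have h := hmono.derivWithin_nonneg (x := u)
    rw [derivWithin_of_isOpen isOpen_Ioi hu, (hd u hu).deriv] at h
    exact sub_nonneg.1 (nonneg_of_mul_nonneg_right h (Real.rpow_pos_of_pos hu _))
  · intro h
    refine monotoneOn_of_deriv_nonneg (convex_Ioi 0)
      (fun u hu => (hd u hu).continuousAt.continuousWithinAt) ?_ ?_ <;> rw [interior_Ioi]
    · exact fun u hu => (hd u hu).differentiableAt.differentiableWithinAt
    · intro u hu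
      rw [(hd u hu).deriv]
      exact mul_nonneg (Real.rpow_nonneg (le_of_lt hu) _) (sub_nonneg.2 (h u hu))

/-- **Condition (A) as a structure theorem for `F`.**
Let `f : ℝ → ℝ` be continuous with `f > 0` on `(0,∞)`, `F u = ∫₀ᵘ f`, and
`ε > 0`.  Then `(2+ε) F(u) ≤ u f(u)` for all `u > 0` (condition (A)) if and
only if there is a nondecreasing nonnegative function `h` on `(0,∞)` with
`F(u) = u^{2+ε} h(u)` for all `u > 0`. -/
theorem conditionA_iff_structure
    (f : ℝ → ℝ) (hf : Continuous f) (hfpos : ∀ u : ℝ, 0 < u → 0 < f u)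
    (ε : ℝ) (hε : 0 < ε) :
    (∀ u : ℝ, 0 < u → (2 + ε) * (∫ s in (0:ℝ)..u, f s) ≤ u * f u) ↔
      ∃ h : ℝ → ℝ, MonotoneOn h (Set.Ioi 0) ∧ (∀ u : ℝ, 0 < u → 0 ≤ h u) ∧
        ∀ u : ℝ, 0 < u → (∫ s in (0:ℝ)..u, f s) = u ^ (2 + ε) * h u := by
  rw [← monotoneOn_mul_rpow_neg_iff (2 + ε) fun u _ =>
    (hf.integral_hasStrictDerivAt 0 u).hasDerivAt]
  constructor
  · intro hmono
    refine ⟨_, hmono, fun u hu => mul_nonneg ?_ (Real.rpow_nonneg hu.le _), fun u hu => ?_⟩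
    · exact (intervalIntegral.intervalIntegral_pos_of_pos_on (hf.intervalIntegrable 0 u)
        (fun x hx => hfpos x hx.1) hu).le
    · rw [mul_left_comm, ← Real.rpow_add hu, add_neg_cancel, Real.rpow_zero, mul_one]
  · rintro ⟨h, hmono, -, hFh⟩
    refine hmono.congr fun u hu => ?_
    rw [hFh u hu, mul_right_comm, ← Real.rpow_add hu, add_neg_cancel, Real.rpow_zero, one_mul]
end

section
/- Let f : ℝ → ℝ be continuous with F(u) = ∫₀^u f(s) ds. Then there exist constants ε, β, γ > 0 with β ≤ ελ₀/2 such that (2+ε) F(u) ≤ u f(u) + β u² + γ for all u > 0 (condition (C)) if and only if there exist constants ε > 0, a ∈ (0, λ₀/2], b > 0 and a nondecreasing function h : (0,∞) → ℝ such that F(u) = u^{2+ε} h(u) + a u² + b for all u > 0. -/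
open Finset

/-- The normalised remainder `u ^ (-(2 + ε)) * (F u - a u² - b)` is differentiable on `(0, ∞)`, and
its derivative is the defect in condition (C) up to a positive factor. -/
lemma hasDerivAt_rpow_mul_primitive_sub {f : ℝ → ℝ} (hf : Continuous f) (ε a b : ℝ) {u : ℝ}
    (hu : 0 < u) :
    HasDerivAt (fun v : ℝ => v ^ (-(2 + ε)) * ((∫ s in (0:ℝ)..v, f s) - a * v ^ 2 - b))
      (u ^ (-(2 + ε) - 1) * (u * f u + ε * a * u ^ 2 + (2 + ε) * b
        - (2 + ε) * ∫ s in (0:ℝ)..u, f s)) u := by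
  have hF : HasDerivAt (fun v : ℝ => ∫ s in (0:ℝ)..v, f s) (f u) u :=
    hf.integral_hasStrictDerivAt 0 u |>.hasDerivAt
  have hpow : HasDerivAt (fun v : ℝ => v ^ (-(2 + ε))) (-(2 + ε) * u ^ (-(2 + ε) - 1)) u :=
    Real.hasDerivAt_rpow_const (Or.inl hu.ne')
  have hsq : HasDerivAt (fun v : ℝ => a * v ^ 2) (a * (2 * u)) u := by
    simpa using (hasDerivAt_pow 2 u).const_mul a
  have hsplit : u ^ (-(2 + ε)) = u ^ (-(2 + ε) - 1) * u := by
    rw [Real.rpow_sub_one hu.ne', div_mul_cancel₀ _ hu.ne']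
  refine (hpow.mul ((hF.sub hsq).sub_const b)).congr_deriv ?_
  simp only [Pi.sub_apply, hsplit]
  ring

/-- Condition (C) with `β = εa` and `γ = (2 + ε)b` is equivalent to monotonicity of the normalised
remainder. -/
lemma monotoneOn_rpow_mul_primitive_sub_iff {f : ℝ → ℝ} (hf : Continuous f) (ε a b : ℝ) :
    MonotoneOn (fun v : ℝ => v ^ (-(2 + ε)) * ((∫ s in (0:ℝ)..v, f s) - a * v ^ 2 - b))
        (Set.Ioi 0) ↔
      ∀ u : ℝ, 0 < u →
        (2 + ε) * (∫ s in (0:ℝ)..u, f s) ≤ u * f u + ε * a * u ^ 2 + (2 + ε) * b := by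
  constructor
  · intro hmono u hu
    have hderiv := hasDerivAt_rpow_mul_primitive_sub hf ε a b hu
    have hnonneg := hmono.derivWithin_nonneg (x := u)
    rw [hderiv.hasDerivWithinAt.derivWithin (isOpen_Ioi.uniqueDiffWithinAt hu)] at hnonneg
    exact sub_nonneg.mp (nonneg_of_mul_nonneg_right hnonneg (Real.rpow_pos_of_pos hu _))
  · intro hC
    refine monotoneOn_of_deriv_nonneg (convex_Ioi 0)
      (fun u hu => (hasDerivAt_rpow_mul_primitive_sub hf ε a b hu).continuousAt.continuousWithinAt)
      ?_ ?_ <;> rw [interior_Ioi]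
    · exact fun u hu => (hasDerivAt_rpow_mul_primitive_sub hf ε a b
        hu).differentiableAt.differentiableWithinAt
    · intro u hu
      rw [(hasDerivAt_rpow_mul_primitive_sub hf ε a b hu).deriv]
      exact mul_nonneg (Real.rpow_pos_of_pos hu _).le (sub_nonneg.mpr (hC u hu))

/-- **Condition (C) as a structure theorem for `F`.**
Network: finite `V = S̄`, nonempty interior `S`, nonempty boundary `Sᶜ`,
symmetric nonnegative weight `ω` vanishing on the diagonal; `λ₀` is the first
Dirichlet eigenvalue, i.e. the minimum of the Rayleigh quotient over nonzero
functions vanishing on `∂S`.  Let `f : ℝ → ℝ` be continuous and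
`F u = ∫₀ᵘ f`.  Then there exist `ε, β, γ > 0` with `β ≤ ελ₀/2` such that
`(2+ε) F(u) ≤ u f(u) + β u² + γ` for all `u > 0` (condition (C)) if and only
if there exist `ε > 0`, `a ∈ (0, λ₀/2]`, `b > 0` and a nondecreasing
`h : (0,∞) → ℝ` with `F(u) = u^{2+ε} h(u) + a u² + b` for all `u > 0`. -/
theorem conditionC_iff_structure {V : Type*} [Fintype V] [DecidableEq V]
    (S : Finset V) (hS : S.Nonempty) (hSc : Sᶜ.Nonempty)
    (ω : V → V → ℝ)
    (hsymm : ∀ x y, ω x y = ω y x)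
    (hnonneg : ∀ x y, 0 ≤ ω x y)
    (hdiag : ∀ x, ω x x = 0)
    (lam : ℝ)
    (hlam : IsLeast {r : ℝ | ∃ w : V → ℝ, (∀ x ∉ S, w x = 0) ∧ w ≠ 0 ∧
        r = ((1 / 2) * ∑ x, ∑ y, (w x - w y) ^ 2 * ω x y) / (∑ x, (w x) ^ 2)} lam)
    (f : ℝ → ℝ) (hf : Continuous f) :
    (∃ ε β γ : ℝ, 0 < ε ∧ 0 < β ∧ 0 < γ ∧ β ≤ ε * lam / 2 ∧
        ∀ u : ℝ, 0 < u →
          (2 + ε) * (∫ s in (0:ℝ)..u, f s) ≤ u * f u + β * u ^ 2 + γ) ↔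
      (∃ ε a b : ℝ, ∃ h : ℝ → ℝ, 0 < ε ∧ 0 < a ∧ a ≤ lam / 2 ∧ 0 < b ∧
        MonotoneOn h (Set.Ioi 0) ∧
        ∀ u : ℝ, 0 < u →
          (∫ s in (0:ℝ)..u, f s) = u ^ (2 + ε) * h u + a * u ^ 2 + b) := by
  constructor
  · rintro ⟨ε, β, γ, hε, hβ, hγ, hle, hC⟩
    have h2ε : 0 < 2 + ε := by linarith
    refine ⟨ε, β / ε, γ / (2 + ε), _, hε, div_pos hβ hε, ?_, div_pos hγ h2ε,
      (monotoneOn_rpow_mul_primitive_sub_iff hf ε (β / ε) (γ / (2 + ε))).mpr ?_, ?_⟩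
    · rw [div_le_iff₀ hε]
      linarith
    · intro u hu
      rw [mul_div_cancel₀ β hε.ne', mul_div_cancel₀ γ h2ε.ne']
      exact hC u hu
    · intro u hu
      rw [Real.rpow_neg hu.le, mul_inv_cancel_left₀ (Real.rpow_pos_of_pos hu _).ne']
      ring
  · rintro ⟨ε, a, b, h, hε, ha, hle, hb, hmono, hF⟩
    refine ⟨ε, ε * a, (2 + ε) * b, hε, by positivity, by positivity, ?_, ?_⟩
    · rw [mul_div_assoc]
      gcongr
    · refine (monotoneOn_rpow_mul_primitive_sub_iff hf ε a b).mp (hmono.congr fun u hu => ?_)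
      have hu : 0 < u := hu
      simp only [hF u hu]
      rw [Real.rpow_neg hu.le, add_assoc, sub_sub, add_sub_cancel_right,
        inv_mul_cancel_left₀ (Real.rpow_pos_of_pos hu _).ne']
end

section
/- Let f : ℝ → ℝ be continuous with F(u) = ∫₀^u f(s) ds. Suppose f satisfies condition (C) with constants ε, β, γ > 0 and β ≤ ελ₀/2, i.e. (2+ε) F(u) ≤ u f(u) + β u² + γ for all u > 0, and suppose f(u) ≥ λ u for all u > 0, where λ > λ₀. Then there exist constants m > 0 and δ > 0 such that f(u) ≥ δ u^{1+ε} for all u ≥ m. -/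
open Finset

/-- If `p * K u ≤ u * K' u` on the positive half-line, then `K u / u ^ p` is nondecreasing there. -/
theorem monotoneOn_mul_rpow_neg_of_mul_le_mul_deriv {K K' : ℝ → ℝ} {p : ℝ}
    (hK : ∀ u, 0 < u → HasDerivAt K (K' u) u) (hp : ∀ u, 0 < u → p * K u ≤ u * K' u) :
    MonotoneOn (fun u : ℝ => K u * u ^ (-p)) (Set.Ioi 0) := by
  have hd : ∀ u : ℝ, 0 < u → HasDerivAt (fun u : ℝ => K u * u ^ (-p))
      (K' u * u ^ (-p) + K u * (-p * u ^ (-p - 1))) u := fun u hu =>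
    (hK u hu).mul (Real.hasDerivAt_rpow_const (Or.inl hu.ne'))
  refine monotoneOn_of_hasDerivWithinAt_nonneg (convex_Ioi 0)
    (fun u hu => (hd u hu).continuousAt.continuousWithinAt)
    (fun u hu => (hd u (interior_subset hu)).hasDerivWithinAt) fun u hu => ?_
  have hu : 0 < u := interior_subset hu
  have hsplit : u ^ (-p) = u * u ^ (-p - 1) := by
    rw [Real.rpow_sub_one hu.ne']
    field_simp
  have h : 0 ≤ (u * K' u - p * K u) * u ^ (-p - 1) :=
    mul_nonneg (sub_nonneg.2 (hp u hu)) (Real.rpow_nonneg hu.le _)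
  rw [hsplit]
  linarith

/-- A continuous function that dominates `a * u` for `u > 0` has integral at least
`a * u ^ 2 / 2` over `[0, u]`. -/
theorem mul_sq_div_two_le_integral {f : ℝ → ℝ} (hf : Continuous f) {a : ℝ}
    (h : ∀ u : ℝ, 0 < u → a * u ≤ f u) {u : ℝ} (hu : 0 ≤ u) :
    a * u ^ 2 / 2 ≤ ∫ s in (0:ℝ)..u, f s := by
  have hle : (∫ s in (0:ℝ)..u, a * s) ≤ ∫ s in (0:ℝ)..u, f s :=
    intervalIntegral.integral_mono_on_of_le_Ioo hu
      ((continuous_const.mul continuous_id).intervalIntegrable _ _)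
      (hf.intervalIntegrable _ _) fun s hs => h s hs.1
  rw [intervalIntegral.integral_const_mul, integral_id] at hle
  linarith

/-- **Superlinear growth from condition (C) (Lemma 4.1, growth part).**
Network: finite `V = S̄`, nonempty interior `S`, nonempty boundary `Sᶜ`,
symmetric nonnegative weight `ω` vanishing on the diagonal; `λ₀` is the first
Dirichlet eigenvalue (minimum of the Rayleigh quotient over nonzero functions
vanishing on `∂S`).  Let `f : ℝ → ℝ` be continuous with `F u = ∫₀ᵘ f`.
Suppose `f` satisfies condition (C) with constants `ε, β, γ > 0`,
`β ≤ ελ₀/2`, i.e. `(2+ε) F(u) ≤ u f(u) + β u² + γ` for all `u > 0`, and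
`f(u) ≥ λ u` for all `u > 0` with `λ > λ₀`.  Then there exist `m > 0` and
`δ > 0` with `f(u) ≥ δ u^{1+ε}` for all `u ≥ m`. -/
theorem conditionC_superlinear_growth {V : Type*} [Fintype V] [DecidableEq V]
    (S : Finset V) (hS : S.Nonempty) (hSc : Sᶜ.Nonempty)
    (ω : V → V → ℝ)
    (hsymm : ∀ x y, ω x y = ω y x)
    (hnonneg : ∀ x y, 0 ≤ ω x y)
    (hdiag : ∀ x, ω x x = 0)
    (lam0 : ℝ)
    (hlam0 : IsLeast {r : ℝ | ∃ w : V → ℝ, (∀ x ∉ S, w x = 0) ∧ w ≠ 0 ∧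
        r = ((1 / 2) * ∑ x, ∑ y, (w x - w y) ^ 2 * ω x y) / (∑ x, (w x) ^ 2)} lam0)
    (f : ℝ → ℝ) (hf : Continuous f)
    (ε β γ : ℝ) (hε : 0 < ε) (hβ : 0 < β) (hγ : 0 < γ)
    (hβle : β ≤ ε * lam0 / 2)
    (hC : ∀ u : ℝ, 0 < u →
      (2 + ε) * (∫ s in (0:ℝ)..u, f s) ≤ u * f u + β * u ^ 2 + γ)
    (lam : ℝ) (hlamgt : lam0 < lam)
    (hflin : ∀ u : ℝ, 0 < u → lam * u ≤ f u) :
    ∃ m : ℝ, 0 < m ∧ ∃ δ : ℝ, 0 < δ ∧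
      ∀ u : ℝ, m ≤ u → δ * u ^ (1 + ε) ≤ f u := by
  set K : ℝ → ℝ := fun u => (∫ s in (0:ℝ)..u, f s) - β / ε * u ^ 2 - γ / (2 + ε) with hKdef
  have hK : ∀ u : ℝ, 0 < u → HasDerivAt K (f u - β / ε * (2 * u)) u := fun u _ => by
    have hF := intervalIntegral.integral_hasDerivAt_right (hf.intervalIntegrable 0 u)
      hf.stronglyMeasurable.stronglyMeasurableAtFilter hf.continuousAt
    simpa [hKdef] using (hF.sub ((hasDerivAt_pow 2 u).const_mul (β / ε))).sub_const (γ / (2 + ε))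
  have hp : ∀ u : ℝ, 0 < u → (2 + ε) * K u ≤ u * (f u - β / ε * (2 * u)) := fun u hu => by
    have hKu : (2 + ε) * K u = (2 + ε) * (∫ s in (0:ℝ)..u, f s)
        - 2 * (β / ε) * u ^ 2 - β * u ^ 2 - γ := by
      simp only [hKdef]
      field_simp
      ring
    linarith [hC u hu]
  have hmono := monotoneOn_mul_rpow_neg_of_mul_le_mul_deriv hK hp
  have hgap : 0 < lam - lam0 := sub_pos.2 hlamgt
  obtain ⟨m, hm1, hm⟩ : ∃ m : ℝ, 1 ≤ m ∧ γ / (2 + ε) < (lam - lam0) / 2 * m := by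
    refine ⟨1 + γ / (2 + ε) / ((lam - lam0) / 2), le_add_of_nonneg_right (by positivity), ?_⟩
    rw [mul_add, mul_div_cancel₀ _ (by positivity)]
    linarith
  have hm0 : 0 < m := one_pos.trans_le hm1
  have hKm : 0 < K m := by
    have hF := mul_sq_div_two_le_integral hf hflin hm0.le
    have hβε : β / ε ≤ lam0 / 2 := by
      rw [div_le_iff₀ hε]
      linarith
    have h1 : β / ε * m ^ 2 ≤ lam0 / 2 * m ^ 2 := by gcongr
    have h2 : (lam - lam0) / 2 * m ≤ (lam - lam0) / 2 * m ^ 2 := by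
      gcongr
      exact le_self_pow₀ hm1 two_ne_zero
    simp only [hKdef]
    linarith
  have hc : 0 < K m * m ^ (-(2 + ε)) := mul_pos hKm (Real.rpow_pos_of_pos hm0 _)
  refine ⟨m, hm0, (2 + ε) * (K m * m ^ (-(2 + ε))), by positivity, fun u hu => ?_⟩
  have hu0 : 0 < u := hm0.trans_le hu
  have hKu : K m * m ^ (-(2 + ε)) * u ^ (2 + ε) ≤ K u := by
    have h := hmono hm0 hu0 hu
    simp only [] at h
    rwa [Real.rpow_neg hu0.le, ← div_eq_mul_inv (K u),
      le_div_iff₀ (Real.rpow_pos_of_pos hu0 _)] at h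
  have hsplit : u ^ (2 + ε) = u * u ^ (1 + ε) := by
    rw [show 2 + ε = 1 + (1 + ε) by ring, Real.rpow_add hu0, Real.rpow_one]
  refine le_of_mul_le_mul_left ?_ hu0
  have h1 : 0 ≤ u * (β / ε * (2 * u)) := by positivity
  have h2 := mul_le_mul_of_nonneg_left hKu (by positivity : 0 ≤ 2 + ε)
  rw [hsplit] at h2
  linarith [hp u hu0]
end
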